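/- Let p ≥ 4, 1 ≤ a ≤ p−2 and 2 ≤ b ≤ p−1 be integers and let L ≥ 0. If b + a + δ_{a,1} is even then F^{p,0}_{a,b}(L) = q^{φ(a,b)} B^p_{a,b}(L, b+1), while if b + a + δ_{a,1} is odd then F^{p,0}_{a,b}(L) = q^{φ̃(a,b)} B̃^p_{a,b}(L, b+2), for every real q with 0 < q < 1, where φ(a,b) = (b−a)(b−a+1)/4 and φ̃(a,b) = (b−a)(b−a+3)/4. -/

import Mathlib

open Finset

noncomputable section

/-- `(q)_k = ∏_{j=1}^k (1 - q^j)`. -/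
def qPoch (q : ℝ) (k : ℕ) : ℝ := ∏ j ∈ Finset.range k, (1 - q ^ (j + 1))

/-- The Andrews–Baxter `q`-trinomial coefficient `T^n(L,A)`. -/
def qTri (q : ℝ) (n : ℤ) (L : ℕ) (A : ℤ) : ℝ :=
  if |A| ≤ (L : ℤ) then
    ∑ j ∈ Finset.range (L + 1),
      if 0 ≤ (j : ℤ) + A ∧ 0 ≤ (L : ℤ) - 2 * j - A then
        q ^ ((j : ℤ) * ((j : ℤ) + A - n)) * qPoch q L /
          (qPoch q j * qPoch q (((j : ℤ) + A).toNat) * qPoch q (((L : ℤ) - 2 * j - A).toNat))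
      else 0
  else 0

/-- Bosonic polynomial `B^p_{a,b}(L,s)`. -/
def Bpoly (q : ℝ) (p a b s : ℤ) (L : ℕ) : ℝ :=
  ∑' j : ℤ,
    (q ^ (p * (p + 1) * j ^ 2 + j * ((p + 1) * a - p * s)) * qTri q 0 L (2 * p * j + a - b)
      - q ^ ((p * j + a) * ((p + 1) * j + s)) * qTri q 0 L (2 * p * j + a + b))

/-- Bosonic polynomial `B̃^p_{a,b}(L,s)`. -/
def Btpoly (q : ℝ) (p a b s : ℤ) (L : ℕ) : ℝ :=
  ∑' j : ℤ,
    (q ^ (p * (p + 1) * j ^ 2 + j * ((p + 1) * a - p * s)) * qTri q 1 L (2 * p * j + a - b)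
      - q ^ (p * (p + 1) * j ^ 2 + j * ((p + 1) * a + p * (s - 2)) + a * (s - 1) - b)
        * qTri q 1 L (2 * p * j + a + b))

/-- `(q)_∞`. -/
def qPochInf (q : ℝ) : ℝ := ∏' j : ℕ, (1 - q ^ (j + 1))

/-- The matrix `Ĩ_{p-1}`. -/
def ItM (p : ℕ) (i j : Fin (p - 1)) : ℚ :=
  if i.val = 0 then (if j.val = 2 then -1 else 0)
  else if j.val = 0 then (if i.val = 2 then 1 else 0)
  else if i.val = j.val + 1 ∨ j.val = i.val + 1 then 1 else 0

/-- The matrix `C̃_{p-1} = 2·Id - Ĩ_{p-1}`. -/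
def CtM (p : ℕ) (i j : Fin (p - 1)) : ℚ := (if i = j then 2 else 0) - ItM p i j

/-- Unit vector `e_c` (zero if `c` is out of range). -/
def evec (p c : ℕ) : Fin (p - 1) → ℚ := fun i => if i.val = c then 1 else 0

/-- Kronecker delta. -/
def kdel (a b : ℕ) : ℕ := if a = b then 1 else 0

/-- `p̃(n) = 1` if `n` is odd, `0` otherwise. -/
def ptil (n : ℕ) : ℚ := if n % 2 = 1 then 1 else 0

/-- The vector `u^i_{a,b}`. -/
def uvec (p i a b : ℕ) : Fin (p - 1) → ℚ := fun j =>
  (if 1 < a then evec p a j else 0) + (if 1 < b then evec p b j else 0)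
    + ptil (a + kdel a 1 + b + kdel b 1 + (if i = 1 then p - 1 else 0)) * (evec p 1 j - evec p 0 j)

/-- The vector `A^i_{a,b}`. -/
def Avec (p i a b : ℕ) : Fin (p - 1) → ℚ := fun j =>
  (if 1 < b then evec p b j else 0)
    + ptil (a + kdel a 1 + b + kdel b 1 + (if i = 1 then p - 1 else 0)) * evec p 1 j

/-- `q`-binomial coefficient with (possibly non-integral) rational top entry:
it vanishes unless the top is an integer `N` with `0 ≤ m ≤ N`. -/
def qBinQ (q : ℝ) (N : ℚ) (m : ℕ) : ℝ :=
  if N.den = 1 ∧ (m : ℚ) ≤ N then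
    qPoch q N.num.toNat / (qPoch q m * qPoch q (N.num.toNat - m))
  else 0

/-- The quadratic form `Φ(m) = (m·C̃m)/4 - (A·m)/2`. -/
def PhiQ (p : ℕ) (A : Fin (p - 1) → ℚ) (m : Fin (p - 1) → ℕ) : ℚ :=
  (∑ i, ∑ j, (m i : ℚ) * CtM p i j * (m j : ℚ)) / 4 - (∑ j, A j * (m j : ℚ)) / 2

/-- The vector `(½ Ĩ m + L e₀ + ½ u)`. -/
def topVec (p L : ℕ) (u : Fin (p - 1) → ℚ) (m : Fin (p - 1) → ℕ) (i : Fin (p - 1)) : ℚ :=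
  (∑ j, ItM p i j * (m j : ℚ)) / 2 + (L : ℚ) * evec p 0 i + u i / 2

/-- The last component `m_{p-2}`. -/
def mlast (p : ℕ) (m : Fin (p - 1) → ℕ) : ℕ :=
  if h : p - 1 ≠ 0 then m ⟨p - 2, by omega⟩ else 0

/-- The fundamental fermionic form `f^p_k(L; u; A)`. -/
def fFerm (q : ℝ) (p k L : ℕ) (u A : Fin (p - 1) → ℚ) : ℝ :=
  ∑' m : Fin (p - 1) → ℕ,
    if mlast p m % 2 = k % 2 then
      q ^ ((PhiQ p A m : ℝ)) * ∏ i, qBinQ q (topVec p L u m i) (m i)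
    else 0

/-- The fermionic polynomial `F^{p,i}_{a,b}(L)`. -/
def Fpoly (q : ℝ) (p i a b L : ℕ) : ℝ :=
  if b = p - 1 then fFerm q p (1 - i) L (uvec p i a b) (Avec p i a b)
  else fFerm q p i L (uvec p i a b) (Avec p i a b)

def phiR (a b : ℝ) : ℝ := (b - a) * (b - a + 1) / 4

def phitR (a b : ℝ) : ℝ := (b - a) * (b - a + 3) / 4

/-- Virasoro character `χ^{p,p+1}_{r,s}(q)` of the minimal model `M(p,p+1)`. -/
def chiV (p r s : ℤ) (q : ℝ) : ℝ :=
  (∑' j : ℤ, (q ^ (p * (p + 1) * j ^ 2 + j * ((p + 1) * r - p * s))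
      - q ^ ((p * j + r) * ((p + 1) * j + s)))) / qPochInf q

/-- Gaussian binomial with integer arguments (zero unless `0 ≤ r ≤ N`). -/
def gb (q : ℝ) (N r : ℤ) : ℝ :=
  if 0 ≤ r ∧ r ≤ N then
    qPoch q N.toNat / (qPoch q r.toNat * qPoch q (N - r).toNat) else 0

/-- Gaussian binomial with top entry `s/2`. -/
def hb (q : ℝ) (s y : ℤ) : ℝ := if Even s then gb q (s / 2) y else 0

lemma qPoch_succ (q : ℝ) (k : ℕ) : qPoch q (k + 1) = qPoch q k * (1 - q ^ (k + 1)) := by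
  simp [qPoch, Finset.prod_range_succ]

lemma qPoch_zero (q : ℝ) : qPoch q 0 = 1 := by simp [qPoch]

lemma one_sub_pow_pos {q : ℝ} (h0 : 0 < q) (h1 : q < 1) (k : ℕ) : 0 < 1 - q ^ (k + 1) := by
  have := pow_lt_one₀ h0.le h1 (Nat.succ_ne_zero k)
  simp only [Nat.succ_eq_add_one] at this
  linarith

lemma qPoch_pos {q : ℝ} (h0 : 0 < q) (h1 : q < 1) (k : ℕ) : 0 < qPoch q k :=
  Finset.prod_pos fun j _ => one_sub_pow_pos h0 h1 j

lemma gb_nat (q : ℝ) (n d : ℕ) :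
    gb q ((n : ℤ) + d) n = qPoch q (n + d) / (qPoch q n * qPoch q d) := by
  unfold gb
  rw [if_pos (by constructor <;> omega)]
  rw [show ((n : ℤ) + d).toNat = n + d by omega, show ((n : ℤ) + d - n).toNat = d by omega,
    Int.toNat_natCast]

lemma gb_neg (q : ℝ) {N r : ℤ} (h : r < 0) : gb q N r = 0 := by
  unfold gb; rw [if_neg (by omega)]

lemma gb_big (q : ℝ) {N r : ℤ} (h : N < r) : gb q N r = 0 := by
  unfold gb; rw [if_neg (by omega)]

lemma gb_zero {q : ℝ} (h0 : 0 < q) (h1 : q < 1) {N : ℤ} (h : 0 ≤ N) : gb q N 0 = 1 := by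
  lift N to ℕ using h
  have := gb_nat q 0 N
  have h2 := (qPoch_pos h0 h1 N).ne'
  simp only [Nat.cast_zero, zero_add, qPoch_zero, one_mul, div_self h2] at this
  exact this

lemma gb_self {q : ℝ} (h0 : 0 < q) (h1 : q < 1) {N : ℤ} (h : 0 ≤ N) : gb q N N = 1 := by
  lift N to ℕ using h
  have := gb_nat q N 0
  have h2 := (qPoch_pos h0 h1 N).ne'
  simp only [Nat.cast_zero, add_zero, qPoch_zero, mul_one, div_self h2] at this
  exact this

lemma gb_nonneg {q : ℝ} (h0 : 0 < q) (h1 : q < 1) (N r : ℤ) : 0 ≤ gb q N r := by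
  unfold gb
  split_ifs
  · exact div_nonneg (qPoch_pos h0 h1 _).le
      (mul_pos (qPoch_pos h0 h1 _) (qPoch_pos h0 h1 _)).le
  · exact le_rfl

lemma gb_rec {q : ℝ} (h0 : 0 < q) (h1 : q < 1) {N : ℤ} (h : 0 ≤ N) (r : ℤ) :
    gb q (N + 1) (r + 1) = gb q N r + q ^ (r + 1) * gb q N (r + 1) ∧
    gb q (N + 1) (r + 1) = q ^ (N - r) * gb q N r + gb q N (r + 1) := by
  rcases lt_trichotomy r (-1) with hr | hr | hr
  · simp [gb_neg q (show r + 1 < 0 by omega), gb_neg q (show r < 0 by omega)]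
  · subst hr
    simp [gb_neg q (show (-1 : ℤ) < 0 by omega), gb_zero h0 h1 h,
      gb_zero h0 h1 (show 0 ≤ N + 1 by omega)]
  · rcases lt_trichotomy r N with hN | hN | hN
    · obtain ⟨n, rfl⟩ : ∃ n : ℕ, r = n := ⟨r.toNat, by omega⟩
      obtain ⟨d, rfl⟩ : ∃ d : ℕ, N = (n : ℤ) + ((d + 1 : ℕ) : ℤ) :=
        ⟨(N - n - 1).toNat, by push_cast; omega⟩
      have e1 := gb_nat q (n + 1) (d + 1)
      have e2 := gb_nat q n (d + 1)
      have e3 := gb_nat q (n + 1) d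
      rw [show ((n + 1 : ℕ) : ℤ) + ((d + 1 : ℕ) : ℤ) = (n : ℤ) + ((d + 1 : ℕ) : ℤ) + 1 by
        push_cast; ring] at e1
      rw [show ((n + 1 : ℕ) : ℤ) + (d : ℤ) = (n : ℤ) + ((d + 1 : ℕ) : ℤ) by
        push_cast; ring] at e3
      rw [show ((n + 1 : ℕ) : ℤ) = (n : ℤ) + 1 by push_cast; ring] at e1 e3
      rw [e1, e2, e3, show (n : ℤ) + ((d + 1 : ℕ) : ℤ) - n = ((d + 1 : ℕ) : ℤ) by ring,
        show (n : ℤ) + 1 = ((n + 1 : ℕ) : ℤ) by push_cast; ring, zpow_natCast, zpow_natCast]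
      rw [show n + 1 + (d + 1) = (n + d + 1) + 1 by ring, show n + (d + 1) = n + d + 1 by ring,
        show n + 1 + d = n + d + 1 by ring, qPoch_succ q (n + d + 1), qPoch_succ q n,
        qPoch_succ q d]
      have a1 := (qPoch_pos h0 h1 n).ne'
      have a2 := (qPoch_pos h0 h1 d).ne'
      have a3 := (one_sub_pow_pos h0 h1 n).ne'
      have a4 := (one_sub_pow_pos h0 h1 d).ne'
      constructor
      · field_simp
        ring
      · field_simp
        ring
    · subst hN
      simp [gb_self h0 h1 h, gb_self h0 h1 (show 0 ≤ r + 1 by omega),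
        gb_big q (show r < r + 1 by omega)]
    · simp [gb_big q hN, gb_big q (show N + 1 < r + 1 by omega), gb_big q (show N < r + 1 by omega)]

lemma hb_nonneg {q : ℝ} (h0 : 0 < q) (h1 : q < 1) (s y : ℤ) : 0 ≤ hb q s y := by
  unfold hb; split_ifs
  · exact gb_nonneg h0 h1 _ _
  · exact le_rfl

lemma hb_ne {q : ℝ} {s y : ℤ} (h : hb q s y ≠ 0) : Even s ∧ 0 ≤ y ∧ 2 * y ≤ s := by
  unfold hb at h
  split_ifs at h with h1
  · refine ⟨h1, ?_, ?_⟩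
    · by_contra h2; exact h (gb_neg q (by omega))
    · by_contra h2; exact h (gb_big q (by omega))
  · simp at h

lemma hb_neg (q : ℝ) {s y : ℤ} (h : y < 0) : hb q s y = 0 := by
  by_contra h1; have := hb_ne h1; omega

lemma hb_zero {q : ℝ} (h0 : 0 < q) (h1 : q < 1) {s : ℤ} (h : 0 ≤ s) (he : Even s) :
    hb q s 0 = 1 := by
  unfold hb; rw [if_pos he, gb_zero h0 h1 (by omega)]

lemma hb_rec {q : ℝ} (h0 : 0 < q) (h1 : q < 1) {s : ℤ} (h : -1 ≤ s) (y : ℤ) :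
    hb q (s + 2) (y + 1) = hb q s y + q ^ (y + 1) * hb q s (y + 1) := by
  unfold hb
  by_cases he : Even s
  · have he2 : Even (s + 2) := by simpa [Int.even_add] using he
    have : 0 ≤ s := by
      obtain ⟨r, hr⟩ := he; omega
    rw [if_pos he, if_pos he, if_pos he2, show (s + 2) / 2 = s / 2 + 1 by omega]
    exact (gb_rec h0 h1 (by omega) y).1
  · have he2 : ¬ Even (s + 2) := by simpa [Int.even_add] using he
    simp [he, he2]

/-- bounded second argument -/
def BD (f : ℤ → ℤ → ℝ) : Prop := ∃ K : ℤ, ∀ y z, f y z ≠ 0 → 0 ≤ z ∧ z ≤ y + K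

lemma BD.summ {f : ℤ → ℤ → ℝ} (h : BD f) (g : ℤ → ℝ) (y c : ℤ) :
    Summable fun z => g z * f y (z + c) := by
  obtain ⟨K, hK⟩ := h
  apply summable_of_hasFiniteSupport
  apply (Set.finite_Icc (-c) (y + K - c)).subset
  intro z hz
  have := hK y (z + c) (right_ne_zero_of_mul hz)
  constructor <;> omega

lemma BD.summ0 {f : ℤ → ℤ → ℝ} (h : BD f) (g : ℤ → ℝ) (y : ℤ) :
    Summable fun z => g z * f y z := by simpa using h.summ g y 0

lemma BD.summ1 {f : ℤ → ℤ → ℝ} (h : BD f) (y : ℤ) :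
    Summable fun z => f y z := by simpa using h.summ0 1 y

/-- One step of the chain recursion. -/
def step (t : ℝ) (c : ℤ) (f : ℤ → ℤ → ℝ) (x y : ℤ) : ℝ :=
  t ^ ((x - y) ^ 2) * ∑' z : ℤ, hb (t ^ 4) (x + z + c) y * f y z

lemma step_ne {t : ℝ} {c : ℤ} {f : ℤ → ℤ → ℝ} {x y : ℤ} (h : step t c f x y ≠ 0) :
    ∃ z, Even (x + z + c) ∧ 0 ≤ y ∧ 2 * y ≤ x + z + c ∧ f y z ≠ 0 := by
  by_contra hc
  apply h
  unfold step
  rw [show (fun z : ℤ => hb (t ^ 4) (x + z + c) y * f y z) = fun _ => 0 from ?_]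
  · simp
  · funext z
    by_contra hz
    exact hc ⟨z, (hb_ne (left_ne_zero_of_mul hz)).1, (hb_ne (left_ne_zero_of_mul hz)).2.1,
      (hb_ne (left_ne_zero_of_mul hz)).2.2, right_ne_zero_of_mul hz⟩

lemma step_BD {t : ℝ} {c : ℤ} {f : ℤ → ℤ → ℝ} (h : BD f) : BD (step t c f) := by
  obtain ⟨K, hK⟩ := h
  refine ⟨K + c, fun x y hxy => ?_⟩
  obtain ⟨z, h1, h2, h3, h4⟩ := step_ne hxy
  have := hK _ _ h4
  constructor <;> omega

lemma tsum_shift (F : ℤ → ℝ) (c : ℤ) : ∑' z, F z = ∑' z, F (z + c) :=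
  ((Equiv.addRight c).tsum_eq F).symm

lemma q4 {t : ℝ} (_ht : 0 < t) (n : ℤ) : (t ^ 4) ^ n = t ^ (4 * n) := by
  rw [zpow_mul]; norm_cast

/-- The relation propagated along the chain. -/
def ChRel (t : ℝ) (A B C : ℤ → ℤ → ℝ) : Prop :=
  ∀ x y, 0 ≤ x → A (x + 1) (y + 1) - B x y - C x y + A (x - 1) (y - 1)
    - t ^ (4 * x) * A (x - 1) (y + 1) = 0

lemma step_ChRel {t : ℝ} (ht0 : 0 < t) (ht1 : t < 1) {c : ℤ} (hc : 0 ≤ c) {A B C : ℤ → ℤ → ℝ}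
    (hA : BD A) (hB : BD B) (hC : BD C) (h : ChRel t A B C) :
    ChRel t (step t c A) (step t c B) (step t c C) := by
  intro x y hx
  have q0 : 0 < t ^ 4 := by positivity
  have q1 : t ^ 4 < 1 := pow_lt_one₀ ht0.le ht1 (by norm_num)
  have hAneg : ∀ y z, z < 0 → A y z = 0 := by
    obtain ⟨K, hK⟩ := hA
    intro y z hz
    by_contra h1
    have := hK y z h1
    omega
  set T := t ^ ((x - y) ^ 2) with hT
  have h1 : step t c A (x + 1) (y + 1) =
      T * ∑' z, hb (t ^ 4) (x + z + c + 2) (y + 1) * A (y + 1) (z + 1) := by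
    unfold step
    rw [tsum_shift _ 1, show x + 1 - (y + 1) = x - y by ring]
    congr 2; funext z; congr 2; ring
  have h4 : step t c A (x - 1) (y - 1) =
      T * ∑' z, hb (t ^ 4) (x + z + c - 2) (y - 1) * A (y - 1) (z + -1) := by
    unfold step
    rw [tsum_shift _ (-1), show x - 1 - (y - 1) = x - y by ring]
    congr 2; funext z; congr 2; ring
  have h5 : t ^ (4 * x) * step t c A (x - 1) (y + 1) =
      T * (t ^ (4 * (y + 1)) * ∑' z, hb (t ^ 4) (x + z + c) (y + 1) * A (y + 1) (z + 1)) := by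
    unfold step
    rw [tsum_shift _ 1, ← mul_assoc, ← mul_assoc, hT, ← zpow_add₀ ht0.ne', ← zpow_add₀ ht0.ne']
    congr 1
    · congr 1; ring
    · congr 1; funext z; congr 2; ring
  have E1 : ∑' z, hb (t ^ 4) (x + z + c + 2) (y + 1) * A (y + 1) (z + 1) =
      ∑' z, hb (t ^ 4) (x + z + c) y * A (y + 1) (z + 1) +
      t ^ (4 * (y + 1)) * ∑' z, hb (t ^ 4) (x + z + c) (y + 1) * A (y + 1) (z + 1) := by
    rw [← tsum_mul_left, ← (hA.summ _ _ _).tsum_add ((hA.summ _ _ _).mul_left _)]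
    congr 1; funext z
    by_cases hz : z + 1 < 0
    · simp [hAneg _ _ hz]
    · rw [hb_rec q0 q1 (by omega), q4 ht0]; ring
  have E2 : ∑' z, hb (t ^ 4) (x + z + c) y * B y z + ∑' z, hb (t ^ 4) (x + z + c) y * C y z =
      ∑' z, hb (t ^ 4) (x + z + c) y * A (y + 1) (z + 1) +
      ∑' z, hb (t ^ 4) (x + z + c) y * A (y - 1) (z + -1) -
      t ^ (4 * y) * ∑' z, hb (t ^ 4) (x + z + c) y * A (y - 1) (z + 1) := by
    rw [← tsum_mul_left, ← (hB.summ0 _ _).tsum_add (hC.summ0 _ _),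
      ← (hA.summ _ _ _).tsum_add (hA.summ _ _ _),
      ← ((hA.summ _ _ _).add (hA.summ _ _ _)).tsum_sub ((hA.summ _ _ _).mul_left _)]
    congr 1; funext z
    by_cases hy : y < 0
    · simp [hb_neg _ hy]
    · have := h y z (by omega)
      rw [sub_eq_add_neg z 1] at this
      linear_combination (-hb (t ^ 4) (x + z + c) y) * this
  have E3 : ∑' z, hb (t ^ 4) (x + z + c) y * A (y - 1) (z + 1) =
      ∑' z, hb (t ^ 4) (x + z + c - 2) y * A (y - 1) (z + -1) := by
    rw [tsum_shift _ (-2)]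
    congr 1; funext z; congr 2 <;> ring
  have E4 : ∑' z, hb (t ^ 4) (x + z + c) y * A (y - 1) (z + -1) =
      ∑' z, hb (t ^ 4) (x + z + c - 2) (y - 1) * A (y - 1) (z + -1) +
      t ^ (4 * y) * ∑' z, hb (t ^ 4) (x + z + c - 2) y * A (y - 1) (z + -1) := by
    rw [← tsum_mul_left, ← (hA.summ _ _ _).tsum_add ((hA.summ _ _ _).mul_left _)]
    congr 1; funext z
    by_cases hz : z + -1 < 0
    · simp [hAneg _ _ hz]
    · have := hb_rec q0 q1 (show -1 ≤ x + z + c - 2 by omega) (y - 1)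
      rw [sub_add_cancel, sub_add_cancel, q4 ht0] at this
      rw [this]; ring
  rw [h1, h4, h5]
  have h2 : step t c B x y = T * ∑' z, hb (t ^ 4) (x + z + c) y * B y z := rfl
  have h3 : step t c C x y = T * ∑' z, hb (t ^ 4) (x + z + c) y * C y z := rfl
  rw [h2, h3]
  linear_combination T * E1 - T * E2 - T * E4 + T * t ^ (4 * y) * E3

/-- terminal function of the chain -/
def V0 (x y : ℤ) : ℝ := if x = 0 ∧ y = 0 then 1 else 0

/-- the source of the boundary label `a` -/
def csrc (a n : ℕ) : ℤ := if n = a then 1 else 0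

/-- the chain with only the source `a` -/
def Vc (t : ℝ) (a : ℕ) : ℕ → ℤ → ℤ → ℝ
  | 0 => V0
  | n + 1 => step t (csrc a n) (Vc t a n)

/-- chain with second source inserted at the end of level `m` -/
def Yc (t : ℝ) (a m : ℕ) (x y : ℤ) : ℝ := t ^ (-2 * x - 1) * Vc t a m (x + 1) y

/-- the chain with two sources -/
def Qc (t : ℝ) (a m : ℕ) : ℕ → ℤ → ℤ → ℝ
  | 0 => Yc t a m
  | j + 1 => step t (csrc a (m + j)) (Qc t a m j)

lemma csrc_nonneg (a n : ℕ) : 0 ≤ csrc a n := by unfold csrc; split_ifs <;> simp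

lemma Vc_BD (t : ℝ) (a n : ℕ) : BD (Vc t a n) := by
  induction n with
  | zero =>
    refine ⟨0, fun y z h => ?_⟩
    have : y = 0 ∧ z = 0 := by
      by_contra hc; exact h (by simp [Vc, V0, hc])
    omega
  | succ n ih => exact step_BD ih

lemma Yc_BD (t : ℝ) (a m : ℕ) : BD (Yc t a m) := by
  obtain ⟨K, hK⟩ := Vc_BD t a m
  refine ⟨K + 1, fun y z h => ?_⟩
  have := hK _ _ (right_ne_zero_of_mul h)
  omega

lemma Qc_BD (t : ℝ) (a m j : ℕ) : BD (Qc t a m j) := by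
  induction j with
  | zero => exact Yc_BD t a m
  | succ j ih => exact step_BD ih

lemma BD.smul {f : ℤ → ℤ → ℝ} (h : BD f) (c : ℝ) : BD (fun x y => c * f x y) := by
  obtain ⟨K, hK⟩ := h
  exact ⟨K, fun y z hz => hK _ _ (right_ne_zero_of_mul hz)⟩

lemma BD.neg {f : ℤ → ℤ → ℝ} (h : BD f) {y z : ℤ} (hz : z < 0) : f y z = 0 := by
  obtain ⟨K, hK⟩ := h
  by_contra h1
  have := hK y z h1
  omega

lemma step_smul (t : ℝ) (c : ℤ) (r : ℝ) (f : ℤ → ℤ → ℝ) :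
    step t c (fun x y => r * f x y) = fun x y => r * step t c f x y := by
  funext x y
  unfold step
  rw [mul_left_comm]
  congr 1
  rw [← tsum_mul_left]
  congr 1; funext z; ring

lemma star {t : ℝ} (ht0 : 0 < t) (ht1 : t < 1) (a : ℕ) (m : ℕ) (y z : ℤ) (hy : 0 ≤ y) :
    Qc t a m 1 y z = t ^ (-2 * (y + 1)) * Vc t a (m + 1) (y + 2) (z + 1)
      - t ^ (2 * (y + 1)) * Vc t a (m + 1) y (z + 1) := by
  have q0 : 0 < t ^ 4 := by positivity
  have q1 : t ^ 4 < 1 := pow_lt_one₀ ht0.le ht1 (by norm_num)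
  have hF := Vc_BD t a m
  have hc := csrc_nonneg a m
  have E1 : ∑' w, hb (t ^ 4) (y + w + csrc a m + 2) (z + 1) * Vc t a m (z + 1) w =
      ∑' w, hb (t ^ 4) (y + w + csrc a m) z * Vc t a m (z + 1) w +
      t ^ (4 * (z + 1)) * ∑' w, hb (t ^ 4) (y + w + csrc a m) (z + 1) * Vc t a m (z + 1) w := by
    rw [← tsum_mul_left, ← (hF.summ0 _ _).tsum_add ((hF.summ0 _ _).mul_left _)]
    congr 1; funext w
    by_cases hw : w < 0
    · simp [hF.neg hw]
    · rw [hb_rec q0 q1 (by omega), q4 ht0]; ring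
  have h1 : Vc t a (m + 1) (y + 2) (z + 1) = t ^ ((y + 2 - (z + 1)) ^ 2) *
      ∑' w, hb (t ^ 4) (y + w + csrc a m + 2) (z + 1) * Vc t a m (z + 1) w := by
    change step _ _ _ _ _ = _
    unfold step
    congr 2; funext w; congr 2; ring
  have h2 : Vc t a (m + 1) y (z + 1) = t ^ ((y - (z + 1)) ^ 2) *
      ∑' w, hb (t ^ 4) (y + w + csrc a m) (z + 1) * Vc t a m (z + 1) w := rfl
  have h3 : Qc t a m 1 y z = t ^ ((y - z) ^ 2) * (t ^ (-2 * z - 1) *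
      ∑' w, hb (t ^ 4) (y + w + csrc a m) z * Vc t a m (z + 1) w) := by
    change step _ _ _ _ _ = _
    unfold step
    congr 1
    rw [← tsum_mul_left]
    congr 1; funext w
    change _ * (t ^ (-2 * z - 1) * _) = _
    rw [Nat.add_zero]
    ring
  rw [h1, h2, h3, E1]
  have e1 : t ^ (-2 * (y + 1)) * t ^ ((y + 2 - (z + 1)) ^ 2) =
      t ^ ((y - z) ^ 2) * t ^ (-2 * z - 1) := by
    rw [← zpow_add₀ ht0.ne', ← zpow_add₀ ht0.ne']; congr 1; ring
  have e2 : t ^ (2 * (y + 1)) * t ^ ((y - (z + 1)) ^ 2) =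
      t ^ ((y - z) ^ 2) * t ^ (-2 * z - 1) * t ^ (4 * (z + 1)) := by
    rw [← zpow_add₀ ht0.ne', ← zpow_add₀ ht0.ne', ← zpow_add₀ ht0.ne']; congr 1; ring
  generalize t ^ (-2 * (y + 1)) = a1 at *
  generalize t ^ ((y + 2 - (z + 1)) ^ 2) = a2 at *
  generalize t ^ (2 * (y + 1)) = a3 at *
  generalize t ^ ((y - (z + 1)) ^ 2) = a4 at *
  generalize t ^ ((y - z) ^ 2) = a5 at *
  generalize t ^ (-2 * z - 1) = a6 at *
  generalize t ^ (4 * (z + 1)) = a7 at *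
  generalize (∑' w, hb (t ^ 4) (y + w + csrc a m) z * Vc t a m (z + 1) w) = S1
  generalize (∑' w, hb (t ^ 4) (y + w + csrc a m) (z + 1) * Vc t a m (z + 1) w) = S2
  linear_combination (- S1 - a7 * S2) * e1 + S2 * e2

lemma base_ChRel {t : ℝ} (ht0 : 0 < t) (ht1 : t < 1) (a : ℕ) (M : ℕ) : ChRel t (Qc t a (M + 1) 1) (fun x y => t⁻¹ * Qc t a M 2 x y)
    (fun x y => t * Qc t a (M + 2) 0 x y) := by
  intro x y hx
  have q0 : 0 < t ^ 4 := by positivity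
  have q1 : t ^ 4 < 1 := pow_lt_one₀ ht0.le ht1 (by norm_num)
  have hF := Vc_BD t a (M + 1)
  have hc := csrc_nonneg a (M + 1)
  set V := Vc t a (M + 1) with hV
  set c := csrc a (M + 1) with hcd
  set T := t ^ ((x - y) ^ 2) with hT
  have z2 : ∀ {u v : ℤ}, t ^ u * t ^ v = t ^ (u + v) := fun {u v} => (zpow_add₀ ht0.ne' u v).symm
  have hA : ∀ x y, Qc t a (M + 1) 1 x y = t ^ ((x - y) ^ 2) * t ^ (-2 * y - 1) *
      ∑' z, hb (t ^ 4) (x + z + c) y * V (y + 1) z := by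
    intro x y
    change step _ _ _ _ _ = _
    unfold step
    rw [mul_assoc]
    congr 1
    rw [← tsum_mul_left]
    congr 1; funext z
    change _ * (t ^ (-2 * y - 1) * _) = _
    rw [Nat.add_zero]
    ring
  have hA1 : Qc t a (M + 1) 1 (x + 1) (y + 1) = T * t ^ (-2 * y - 3) *
      ∑' z, hb (t ^ 4) (x - 1 + z + c + 2) (y + 1) * V (y + 2) z := by
    rw [hA, hT, z2, z2]
    congr 1
    · congr 1; ring
    · congr 1; funext z; congr 2 <;> ring
  have hA2 : Qc t a (M + 1) 1 (x - 1) (y - 1) = T * t ^ (-2 * y + 1) *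
      ∑' z, hb (t ^ 4) (x - 1 + z + c) (y - 1) * V y z := by
    rw [hA, hT, z2, z2]
    congr 1
    · congr 1; ring
    · congr 1; funext z; congr 2; ring
  have hA3 : t ^ (4 * x) * Qc t a (M + 1) 1 (x - 1) (y + 1) = T * t ^ (2 * y + 1) *
      ∑' z, hb (t ^ 4) (x - 1 + z + c) (y + 1) * V (y + 2) z := by
    rw [hA, hT, ← mul_assoc, z2, z2, z2]
    congr 1
    · congr 1; ring
    · congr 1; funext z; congr 2; ring
  have hC : t * Qc t a (M + 2) 0 x y = T * t ^ (-2 * y + 1) *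
      ∑' z, hb (t ^ 4) (x - 1 + z + c + 2) y * V y z := by
    change t * (t ^ (-2 * x - 1) * step _ _ _ _ _) = _
    unfold step
    rw [← mul_assoc, ← mul_assoc, hT, z2]
    nth_rw 1 [← zpow_one t]
    rw [z2, z2]
    congr 1
    · congr 1; ring
    · congr 1; funext z; congr 2; rw [hcd]; ring
  have hB : t⁻¹ * Qc t a M 2 x y = T * t ^ (-2 * y - 3) *
      (∑' z, hb (t ^ 4) (x - 1 + z + c) y * V (y + 2) z)
      - T * t ^ (2 * y + 1) * ∑' z, hb (t ^ 4) (x - 1 + z + c) y * V y z := by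
    change t⁻¹ * step _ _ _ _ _ = _
    unfold step
    by_cases hy : y < 0
    · simp [hb_neg _ hy]
    · have e : ∑' z, hb (t ^ 4) (x + z + csrc a (M + 1)) y * Qc t a M 1 y z =
          t ^ (-2 * (y + 1)) * ∑' z, hb (t ^ 4) (x - 1 + z + c) y * V (y + 2) z
          - t ^ (2 * (y + 1)) * ∑' z, hb (t ^ 4) (x - 1 + z + c) y * V y z := by
        rw [← tsum_mul_left, ← tsum_mul_left,
          ← ((hF.summ0 _ _).mul_left _).tsum_sub ((hF.summ0 _ _).mul_left _),
          tsum_shift _ (-1)]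
        congr 1; funext z
        rw [star ht0 ht1 a M y _ (by omega), neg_add_cancel_right,
          show x + (z + -1) + csrc a (M + 1) = x - 1 + z + c by rw [hcd]; ring]
        ring
      rw [e, ← zpow_neg_one, ← mul_assoc, z2, mul_sub, ← mul_assoc, ← mul_assoc, z2, z2, hT, z2, z2]
      congr 3 <;> ring
  have E1 : ∑' z, hb (t ^ 4) (x - 1 + z + c + 2) (y + 1) * V (y + 2) z =
      ∑' z, hb (t ^ 4) (x - 1 + z + c) y * V (y + 2) z + t ^ (4 * (y + 1)) *
        ∑' z, hb (t ^ 4) (x - 1 + z + c) (y + 1) * V (y + 2) z := by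
    rw [← tsum_mul_left, ← (hF.summ0 _ _).tsum_add ((hF.summ0 _ _).mul_left _)]
    congr 1; funext w
    by_cases hw : w < 0
    · simp [hF.neg hw]
    · rw [hb_rec q0 q1 (by omega), q4 ht0]; ring
  have E2 : ∑' z, hb (t ^ 4) (x - 1 + z + c + 2) y * V y z =
      ∑' z, hb (t ^ 4) (x - 1 + z + c) (y - 1) * V y z + t ^ (4 * y) *
        ∑' z, hb (t ^ 4) (x - 1 + z + c) y * V y z := by
    rw [← tsum_mul_left, ← (hF.summ0 _ _).tsum_add ((hF.summ0 _ _).mul_left _)]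
    congr 1; funext w
    by_cases hw : w < 0
    · simp [hF.neg hw]
    · have := hb_rec q0 q1 (show -1 ≤ x - 1 + w + c by omega) (y - 1)
      rw [sub_add_cancel, q4 ht0] at this
      rw [this]; ring
  simp only [hA1, hA2, hA3, hB, hC, E1, E2]
  have e1 : t ^ (-2 * y - 3) * t ^ (4 * (y + 1)) = t ^ (2 * y + 1) := by
    rw [z2]; congr 1; ring
  have e2 : t ^ (-2 * y + 1) * t ^ (4 * y) = t ^ (2 * y + 1) := by
    rw [z2]; congr 1; ring
  linear_combination T * (∑' z, hb (t ^ 4) (x - 1 + z + c) (y + 1) * V (y + 2) z) * e1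
    - T * (∑' z, hb (t ^ 4) (x - 1 + z + c) y * V y z) * e2

lemma Qc_ChRel {t : ℝ} (ht0 : 0 < t) (ht1 : t < 1) (a : ℕ) (M j : ℕ) : ChRel t (Qc t a (M + 1) (j + 1))
    (fun x y => t⁻¹ * Qc t a M (j + 2) x y) (fun x y => t * Qc t a (M + 2) j x y) := by
  induction j with
  | zero => exact base_ChRel ht0 ht1 a M
  | succ j ih =>
    have := step_ChRel ht0 ht1 (csrc_nonneg a (M + 2 + j)) (Qc_BD _ _ _ _)
      ((Qc_BD _ _ _ _).smul _) ((Qc_BD _ _ _ _).smul _) ih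
    rw [step_smul, step_smul] at this
    have e1 : Qc t a (M + 1) (j + 1 + 1) = step t (csrc a (M + 2 + j)) (Qc t a (M + 1) (j + 1)) := by
      change step _ _ _ = _
      congr 2; omega
    have e2 : Qc t a M (j + 1 + 2) = step t (csrc a (M + 2 + j)) (Qc t a M (j + 2)) := by
      change step _ _ _ = _
      congr 2; omega
    rw [e1, e2]
    exact this

/-- the summed chain -/
def Sc (t : ℝ) (a m j : ℕ) (k : ℤ) : ℝ := ∑' y, Qc t a m j k y

lemma Sc_rec {t : ℝ} (ht0 : 0 < t) (ht1 : t < 1) (a : ℕ) (M j : ℕ) (k : ℤ) (hk : 0 ≤ k) : Sc t a (M + 1) (j + 1) (k + 1) =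
    t⁻¹ * Sc t a M (j + 2) k + t * Sc t a (M + 2) j k
      + (t ^ (4 * k) - 1) * Sc t a (M + 1) (j + 1) (k - 1) := by
  have hA := Qc_BD t a (M + 1) (j + 1)
  have hB := (Qc_BD t a M (j + 2))
  have hC := (Qc_BD t a (M + 2) j)
  have s1 : ∀ (f : ℤ → ℤ → ℝ) (h : BD f) (x c : ℤ), Summable fun y => f x (y + c) := by
    intro f h x c
    simpa using h.summ 1 x c
  have h := fun y => Qc_ChRel ht0 ht1 a M j k y hk
  unfold Sc
  have e1 : ∑' y, Qc t a (M + 1) (j + 1) (k + 1) (y + 1) =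
      ∑' y, (t⁻¹ * Qc t a M (j + 2) k y + t * Qc t a (M + 2) j k y
        + (t ^ (4 * k) * Qc t a (M + 1) (j + 1) (k - 1) (y + 1)
        - Qc t a (M + 1) (j + 1) (k - 1) (y + -1))) := by
    congr 1; funext y
    have := h y
    rw [sub_eq_add_neg y 1] at this
    linear_combination this
  rw [tsum_shift _ 1, e1, Summable.tsum_add (((hB.summ1 _).mul_left _).add ((hC.summ1 _).mul_left _))
    (((s1 _ hA _ _).mul_left _).sub (s1 _ hA _ _)),
    Summable.tsum_add ((hB.summ1 _).mul_left _) ((hC.summ1 _).mul_left _),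
    Summable.tsum_sub ((s1 _ hA _ _).mul_left _) (s1 _ hA _ _), tsum_mul_left, tsum_mul_left,
    tsum_mul_left, ← tsum_shift (fun y => Qc t a (M + 1) (j + 1) (k - 1) y) 1,
    ← tsum_shift (fun y => Qc t a (M + 1) (j + 1) (k - 1) y) (-1)]
  ring

lemma Sc_rec0 {t : ℝ} (ht0 : 0 < t) (ht1 : t < 1) (a : ℕ) (M : ℕ) (k : ℤ) (hk : 0 ≤ k) : Sc t a (M + 1) 0 (k + 1) =
    t⁻¹ * Sc t a M 1 k + t ^ (4 * k) * Sc t a (M + 1) 0 (k - 1) := by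
  have z2 : ∀ {u v : ℤ}, t ^ u * t ^ v = t ^ (u + v) := fun {u v} => (zpow_add₀ ht0.ne' u v).symm
  have hF := Vc_BD t a (M + 1)
  have s1 : ∀ (x c : ℤ), Summable fun y => Vc t a (M + 1) x (y + c) := by
    intro x c
    simpa using hF.summ 1 x c
  have h0 : ∀ x, Sc t a (M + 1) 0 x = t ^ (-2 * x - 1) * ∑' y, Vc t a (M + 1) (x + 1) y := by
    intro x
    rw [← tsum_mul_left]; rfl
  have h1 : Sc t a M 1 k = t ^ (-2 * (k + 1)) * ∑' y, Vc t a (M + 1) (k + 2) y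
      - t ^ (2 * (k + 1)) * ∑' y, Vc t a (M + 1) k y := by
    unfold Sc
    rw [tsum_shift (fun y => Vc t a (M + 1) (k + 2) y) 1, tsum_shift (fun y => Vc t a (M + 1) k y) 1,
      ← tsum_mul_left, ← tsum_mul_left,
      ← Summable.tsum_sub ((s1 _ _).mul_left _) ((s1 _ _).mul_left _)]
    congr 1; funext y
    exact star ht0 ht1 a M k y hk
  rw [h0, h0, h1, show k + 1 + 1 = k + 2 by ring, show k - 1 + 1 = k by ring]
  rw [mul_sub, ← mul_assoc, ← mul_assoc, ← mul_assoc, ← zpow_neg_one, z2, z2, z2]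
  rw [show -2 * (k + 1) - 1 = -1 + -2 * (k + 1) by ring,
    show 4 * k + (-2 * (k - 1) - 1) = -1 + 2 * (k + 1) by ring]
  ring

lemma Qc_zero {t : ℝ} (a : ℕ) (j : ℕ) (x y : ℤ) (hx : 0 ≤ x) : Qc t a 0 j x y = 0 := by
  induction j generalizing x y with
  | zero =>
    change t ^ (-2 * x - 1) * V0 (x + 1) y = 0
    rw [V0, if_neg (by omega), mul_zero]
  | succ j ih =>
    by_contra h
    obtain ⟨z, _, h2, _, h4⟩ := step_ne (show step _ _ _ _ _ ≠ 0 from h)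
    exact h4 (ih y z h2)

lemma Vc_E {t : ℝ} (ht0 : 0 < t) (ht1 : t < 1) (a : ℕ) (n : ℕ) (hn : n ≤ a) : Vc t a n 0 0 = 1 ∧ ∀ x y, 0 ≤ x → Vc t a n x y ≠ 0 →
    Even x ∧ Even y ∧ ((x = 0 ∧ y = 0) ∨ y ≤ x - 2) := by
  have q0 : 0 < t ^ 4 := by positivity
  have q1 : t ^ 4 < 1 := pow_lt_one₀ ht0.le ht1 (by norm_num)
  induction n with
  | zero =>
    refine ⟨by simp [Vc, V0], fun x y _ h => ?_⟩
    have : x = 0 ∧ y = 0 := by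
      by_contra hc; exact h (by simp [Vc, V0, hc])
    rw [this.1, this.2]; simp
  | succ n ih =>
    obtain ⟨ih1, ih2⟩ := ih (by omega)
    have hc : csrc a n = 0 := by unfold csrc; rw [if_neg (by omega)]
    constructor
    · change step _ _ _ _ _ = _
      unfold step
      rw [tsum_eq_single 0]
      · rw [hc, ih1, hb_zero q0 q1] <;> simp
      · intro z hz
        by_contra h1
        have := (ih2 0 z le_rfl (right_ne_zero_of_mul h1)).2.2
        have h3 := (Vc_BD t a n).neg (y := 0) (z := z)
        have : z < 0 := by omega
        exact h1 (by rw [h3 this, mul_zero])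
    · intro x y hx h
      obtain ⟨z, h1, h2, h3, h4⟩ := step_ne (show step _ _ _ _ _ ≠ 0 from h)
      obtain ⟨i1, i2, i3⟩ := ih2 y z h2 h4
      rw [hc] at h1 h3
      have : Even x := by
        rw [add_zero, Int.even_add] at h1; exact h1.2 i2
      refine ⟨this, i1, ?_⟩
      obtain ⟨r, hr⟩ := this
      omega

lemma Vc_F {t : ℝ} (ht0 : 0 < t) (ht1 : t < 1) (a : ℕ) (n : ℕ) (hn : a < n) (x y : ℤ) (hx : 0 ≤ x) (h : Vc t a n x y ≠ 0) : y ≤ x - 1 := by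
  obtain ⟨d, rfl⟩ := Nat.exists_eq_add_of_lt hn
  clear hn
  induction d generalizing x y with
  | zero =>
    obtain ⟨z, h1, h2, h3, h4⟩ := step_ne (show step _ _ _ _ _ ≠ 0 from h)
    obtain ⟨i1, i2, i3⟩ := (Vc_E ht0 ht1 a a le_rfl).2 y z h2 h4
    have hc : csrc a a = 1 := by simp [csrc]
    rw [hc] at h1 h3
    have h5 : (x + z + 1) % 2 = 0 := Int.even_iff.1 h1
    have h6 : z % 2 = 0 := Int.even_iff.1 i2
    omega
  | succ d ih =>
    obtain ⟨z, h1, h2, h3, h4⟩ := step_ne (show step _ _ _ _ _ ≠ 0 from h)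
    have := ih y z h2 h4
    have hc : csrc a (a + (d + 1)) = 0 := by unfold csrc; rw [if_neg (by omega)]
    rw [hc] at h3
    omega

lemma Qc_bound {t : ℝ} (ht0 : 0 < t) (ht1 : t < 1) (a : ℕ) (m j : ℕ) (x y : ℤ) (hx : 0 ≤ x) (h : Qc t a m j x y ≠ 0) :
    y ≤ x ∧ (m + j ≤ a → y ≤ x - 1) := by
  induction j generalizing x y with
  | zero =>
    have h := right_ne_zero_of_mul (show t ^ (-2 * x - 1) * Vc t a m (x + 1) y ≠ 0 from h)
    rcases Nat.lt_or_ge a m with hm | hm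
    · have := Vc_F ht0 ht1 a m hm _ _ (by omega) h
      omega
    · have := (Vc_E ht0 ht1 a m hm).2 _ _ (by omega) h
      omega
  | succ j ih =>
    obtain ⟨z, h1, h2, h3, h4⟩ := step_ne (show step _ _ _ _ _ ≠ 0 from h)
    obtain ⟨i1, i2⟩ := ih y z h2 h4
    by_cases hc : m + j = a
    · have hc1 : csrc a (m + j) = 1 := by simp [csrc, hc]
      rw [hc1] at h3
      have := i2 (by omega)
      omega
    · have hc1 : csrc a (m + j) = 0 := by simp [csrc, hc]
      rw [hc1] at h3
      refine ⟨by omega, fun h5 => ?_⟩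
      have := i2 (by omega)
      omega

lemma Qc_00 {t : ℝ} (ht0 : 0 < t) (ht1 : t < 1) (a : ℕ) (m j : ℕ) : Qc t a m j 0 0 = if m = a + 1 then 1 else 0 := by
  have q0 : 0 < t ^ 4 := by positivity
  have q1 : t ^ 4 < 1 := pow_lt_one₀ ht0.le ht1 (by norm_num)
  induction j with
  | zero =>
    change t ^ (-2 * 0 - 1 : ℤ) * Vc t a m (0 + 1) 0 = _
    rcases Nat.lt_or_ge a m with hm | hm
    · obtain ⟨n, rfl⟩ : ∃ n, m = n + 1 := ⟨m - 1, by omega⟩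
      have e : Vc t a (n + 1) (0 + 1) 0 =
          t ^ ((0 + 1 - 0 : ℤ) ^ 2) * ∑' z, hb (t ^ 4) (0 + 1 + z + csrc a n) 0 * Vc t a n 0 z := rfl
      rw [e]
      by_cases hn : n = a
      · subst hn
        rw [tsum_eq_single 0]
        · rw [(Vc_E ht0 ht1 n n le_rfl).1, hb_zero q0 q1] <;> simp [csrc, ht0.ne']
        · intro z hz
          by_contra h1
          have := ((Vc_E ht0 ht1 n n le_rfl).2 0 z le_rfl (right_ne_zero_of_mul h1)).2.2
          have h3 := (Vc_BD t n n).neg (y := 0) (z := z)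
          have : z < 0 := by omega
          exact h1 (by rw [h3 this, mul_zero])
      · rw [if_neg (by omega), show (fun z : ℤ => hb (t ^ 4) (0 + 1 + z + csrc a n) 0 * Vc t a n 0 z) =
          fun _ => 0 from ?_]
        · simp
        · funext z
          by_contra h1
          have h2 := right_ne_zero_of_mul h1
          have := Vc_F ht0 ht1 a n (by omega) 0 z le_rfl h2
          exact h2 ((Vc_BD t a n).neg (by omega))
    · rw [if_neg (by omega)]
      by_contra h1
      have := (Vc_E ht0 ht1 a m hm).2 _ _ (by omega) (right_ne_zero_of_mul h1)
      simp at this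
  | succ j ih =>
    change step _ _ _ _ _ = _
    unfold step
    rw [tsum_eq_single 0]
    · rw [ih]
      by_cases hm : m = a + 1
      · rw [if_pos hm, hb_zero q0 q1]
        · simp
        · simpa using csrc_nonneg a (m + j)
        · simp [csrc, show ¬ (m + j = a) by omega]
      · simp [hm]
    · intro z hz
      by_contra h1
      have h2 := right_ne_zero_of_mul h1
      have := (Qc_bound ht0 ht1 a m j 0 z le_rfl h2).1
      exact h2 ((Qc_BD t a m j).neg (by omega))

lemma Sc_0 {t : ℝ} (ht0 : 0 < t) (ht1 : t < 1) (a : ℕ) (m j : ℕ) : Sc t a m j 0 = if m = a + 1 then 1 else 0 := by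
  unfold Sc
  rw [tsum_eq_single 0, Qc_00 ht0 ht1]
  intro z hz
  by_contra h2
  have := (Qc_bound ht0 ht1 a m j 0 z le_rfl h2).1
  exact h2 ((Qc_BD t a m j).neg (by omega))

lemma Sc_neg1 {t : ℝ} (ht0 : 0 < t) (ht1 : t < 1) (a : ℕ) (M : ℕ) (hM : a ≤ M + 1) : Sc t a (M + 1) 0 (-1) = if a = M + 1 then t else 0 := by
  have h0 : Sc t a (M + 1) 0 (-1) = t * ∑' y, Vc t a (M + 1) 0 y := by
    rw [← tsum_mul_left]
    unfold Sc
    congr 1; funext y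
    change t ^ (-2 * (-1) - 1 : ℤ) * Vc t a (M + 1) (-1 + 1) y = _
    norm_num
  rw [h0]
  have hneg : ∀ z, z < 0 → Vc t a (M + 1) 0 z = 0 := fun z hz => (Vc_BD t a (M + 1)).neg hz
  split_ifs with h
  · rw [tsum_eq_single 0, (Vc_E ht0 ht1 a (M + 1) (by omega)).1, mul_one]
    intro z hz
    by_contra h2
    have := ((Vc_E ht0 ht1 a (M + 1) (by omega)).2 _ _ le_rfl h2).2.2
    exact h2 (hneg _ (by omega))
  · rw [show (fun y => Vc t a (M + 1) 0 y) = fun _ => 0 from ?_]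
    · simp
    · funext z
      by_contra h2
      have := Vc_F ht0 ht1 a (M + 1) (by omega) _ _ le_rfl h2
      exact h2 (hneg _ (by omega))

/-- Gaussian binomial with lower entry `s/2`. -/
def hg (q : ℝ) (k s : ℤ) : ℝ := if Even s then gb q k (s / 2) else 0

lemma hg_ne {q : ℝ} {k s : ℤ} (h : hg q k s ≠ 0) : Even s ∧ 0 ≤ s ∧ s ≤ 2 * k := by
  unfold hg at h
  split_ifs at h with h1
  · refine ⟨h1, ?_, ?_⟩
    · by_contra h2; exact h (gb_neg q (by omega))
    · by_contra h2; exact h (gb_big q (by obtain ⟨r, hr⟩ := h1; omega))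
  · simp at h

lemma hg_summ (q : ℝ) (k d p : ℤ) (hp : 0 < p) (c : ℤ → ℝ) :
    Summable fun j : ℤ => c j * hg q k (d - 2 * p * j) := by
  apply summable_of_hasFiniteSupport
  have : Set.Finite ((fun j : ℤ => d - 2 * p * j) ⁻¹' (Set.Icc 0 (2 * k))) := by
    apply Set.Finite.preimage _ (Set.finite_Icc _ _)
    intro i _ j _ h
    have h2 : 2 * p * i = 2 * p * j := by
      simp only at h; linarith
    exact mul_left_cancel₀ (by omega) h2
  apply this.subset
  intro j hj
  have := hg_ne (right_ne_zero_of_mul hj)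
  exact ⟨this.2.1, this.2.2⟩

lemma gb_rec3 {q : ℝ} (h0 : 0 < q) (h1 : q < 1) {k : ℤ} (hk : 0 ≤ k) (R : ℤ) :
    gb q (k + 1) R = gb q k R + gb q k (R - 1) + (q ^ k - 1) * gb q (k - 1) (R - 1) := by
  have A := (gb_rec h0 h1 hk (R - 1)).1
  rw [sub_add_cancel] at A
  rcases hk.eq_or_lt with h | h
  · subst h
    by_cases hR : R = 0
    · subst hR; rw [A]; simp [add_comm]
    · rw [A]
      have : gb q 0 R = 0 := by
        unfold gb; rw [if_neg (by omega)]
      rw [this]; simp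
  · obtain ⟨B, C⟩ := gb_rec h0 h1 (show 0 ≤ k - 1 by omega) (R - 1)
    rw [sub_add_cancel, sub_add_cancel] at B C
    have e : q ^ R * q ^ (k - 1 - (R - 1)) = q ^ k := by
      rw [← zpow_add₀ h0.ne']; congr 1; ring
    linear_combination A + q ^ R * C - B + gb q (k - 1) (R - 1) * e

lemma hg_rec3 {q : ℝ} (h0 : 0 < q) (h1 : q < 1) {k : ℤ} (hk : 0 ≤ k) (s : ℤ) :
    hg q (k + 1) s = hg q k s + hg q k (s - 2) + (q ^ k - 1) * hg q (k - 1) (s - 2) := by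
  unfold hg
  by_cases he : Even s
  · have he2 : Even (s - 2) := by simpa [Int.even_sub] using he
    rw [if_pos he, if_pos he, if_pos he2, if_pos he2, show (s - 2) / 2 = s / 2 - 1 by omega]
    exact gb_rec3 h0 h1 hk _
  · have he2 : ¬ Even (s - 2) := by simpa [Int.even_sub] using he
    simp [he, he2]

lemma hg_rec1 {q : ℝ} (h0 : 0 < q) (h1 : q < 1) {k : ℤ} (hk : 1 ≤ k) (s : ℤ) :
    hg q k s - q ^ (k + 1 - s) * hg q k (s - 2) =
      hg q (k - 1) s - q ^ (k + 1 - s) * hg q (k - 1) (s - 4) := by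
  unfold hg
  by_cases he : Even s
  · have he2 : Even (s - 2) := by simpa [Int.even_sub] using he
    have he4 : Even (s - 4) := by
      have : Even (4 : ℤ) := ⟨2, by norm_num⟩
      simpa [Int.even_sub, this] using he
    rw [if_pos he, if_pos he2, if_pos he, if_pos he4, show (s - 2) / 2 = s / 2 - 1 by omega,
      show (s - 4) / 2 = s / 2 - 2 by omega]
    obtain ⟨R, hR⟩ := he
    rw [show s / 2 = R by omega]
    have B := (gb_rec h0 h1 (show 0 ≤ k - 1 by omega) (R - 1)).2
    have C := (gb_rec h0 h1 (show 0 ≤ k - 1 by omega) (R - 2)).1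
    rw [sub_add_cancel, sub_add_cancel] at B
    rw [sub_add_cancel, show R - 2 + 1 = R - 1 by ring] at C
    have e : q ^ (k + 1 - s) * q ^ (R - 1) = q ^ (k - 1 - (R - 1)) := by
      rw [← zpow_add₀ h0.ne']; congr 1; rw [hR]; ring
    linear_combination B - q ^ (k + 1 - s) * C - gb q (k - 1) (R - 1) * e
  · have he2 : ¬ Even (s - 2) := by simpa [Int.even_sub] using he
    have he4 : ¬ Even (s - 4) := by
      have : Even (4 : ℤ) := ⟨2, by norm_num⟩
      simpa [Int.even_sub, this] using he
    simp [he, he2, he4]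

/-- the bosonic kernel -/
def Ib (t : ℝ) (p a k b : ℤ) : ℝ :=
  ∑' j : ℤ, (t ^ (4 * (j * (p * j + a - p))) * hg (t ^ 4) k (k - a + b - 2 * p * j)
    - t ^ (4 * ((j + 1) * (p * j + a))) * hg (t ^ 4) k (k - a - b - 2 * p * j))

lemma Ib_summ (t : ℝ) {p : ℤ} (hp : 0 < p) (a k b : ℤ) : Summable fun j : ℤ =>
    (t ^ (4 * (j * (p * j + a - p))) * hg (t ^ 4) k (k - a + b - 2 * p * j)
    - t ^ (4 * ((j + 1) * (p * j + a))) * hg (t ^ 4) k (k - a - b - 2 * p * j)) :=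
  (hg_summ _ _ _ _ hp _).sub (hg_summ _ _ _ _ hp _)

lemma Ib_rec {t : ℝ} (ht0 : 0 < t) (ht1 : t < 1) {p : ℤ} (hp : 0 < p) (a k b : ℤ) (hk : 0 ≤ k) :
    Ib t p a (k + 1) b = Ib t p a k (b + 1) + Ib t p a k (b - 1)
      + (t ^ (4 * k) - 1) * Ib t p a (k - 1) b := by
  have q0 : 0 < t ^ 4 := by positivity
  have q1 : t ^ 4 < 1 := pow_lt_one₀ ht0.le ht1 (by norm_num)
  have s := Ib_summ t hp a
  unfold Ib
  rw [← tsum_mul_left, ← (s _ _).tsum_add (s _ _),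
    ← ((s _ _).add (s _ _)).tsum_add ((s _ _).mul_left _)]
  congr 1; funext j
  rw [hg_rec3 q0 q1 hk, hg_rec3 q0 q1 hk, q4 ht0]
  rw [show k + 1 - a + b - 2 * p * j - 2 = k - a + (b - 1) - 2 * p * j by ring,
    show k - 1 - a + b - 2 * p * j = k - a + (b - 1) - 2 * p * j by ring,
    show k + 1 - a + b - 2 * p * j = k - a + (b + 1) - 2 * p * j by ring,
    show k + 1 - a - b - 2 * p * j - 2 = k - a - (b + 1) - 2 * p * j by ring,
    show k - 1 - a - b - 2 * p * j = k - a - (b + 1) - 2 * p * j by ring,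
    show k + 1 - a - b - 2 * p * j = k - a - (b - 1) - 2 * p * j by ring]
  ring

lemma Ib_p (t : ℝ) {p : ℤ} (hp : 0 < p) (a k : ℤ) : Ib t p a k p = 0 := by
  unfold Ib
  rw [(hg_summ _ _ _ _ hp _).tsum_sub (hg_summ _ _ _ _ hp _), sub_eq_zero]
  conv_rhs => rw [tsum_shift _ (-1)]
  congr 1; funext j
  congr 2
  · ring
  · ring

lemma Ib_one {t : ℝ} (ht0 : 0 < t) (ht1 : t < 1) (p a k : ℤ) (hk : 1 ≤ k) :
    Ib t p a k 1 = Ib t p a (k - 1) 2 := by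
  have q0 : 0 < t ^ 4 := by positivity
  have q1 : t ^ 4 < 1 := pow_lt_one₀ ht0.le ht1 (by norm_num)
  unfold Ib
  congr 1; funext j
  have h := hg_rec1 q0 q1 hk (k - a + 1 - 2 * p * j)
  rw [q4 ht0] at h
  rw [show k - 1 - a + 2 - 2 * p * j = k - a + 1 - 2 * p * j by ring,
    show k - a - 1 - 2 * p * j = k - a + 1 - 2 * p * j - 2 by ring,
    show k - 1 - a - 2 - 2 * p * j = k - a + 1 - 2 * p * j - 4 by ring]
  have e : t ^ (4 * ((j + 1) * (p * j + a))) = t ^ (4 * (j * (p * j + a - p))) *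
      t ^ (4 * (k + 1 - (k - a + 1 - 2 * p * j))) := by
    rw [← zpow_add₀ ht0.ne']; congr 1; ring
  rw [e]
  linear_combination t ^ (4 * (j * (p * j + a - p))) * h

lemma hg_zero {q : ℝ} (h0 : 0 < q) (h1 : q < 1) (s : ℤ) : hg q 0 s = if s = 0 then 1 else 0 := by
  split_ifs with h
  · subst h; simp [hg, gb_zero h0 h1]
  · by_contra h2
    have := hg_ne h2
    omega

lemma Ib_zero {t : ℝ} (ht0 : 0 < t) (ht1 : t < 1) {p a b : ℤ} (ha : 1 ≤ a) (ha2 : a ≤ p - 2)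
    (hb : 1 ≤ b) (hb2 : b ≤ p - 1) : Ib t p a 0 b = if a = b then 1 else 0 := by
  have q0 : 0 < t ^ 4 := by positivity
  have q1 : t ^ 4 < 1 := pow_lt_one₀ ht0.le ht1 (by norm_num)
  unfold Ib
  rw [tsum_eq_single 0]
  · simp only [hg_zero q0 q1]
    rw [if_neg (show ¬ (0 - a - b - 2 * p * 0 = 0) by omega)]
    by_cases h : a = b
    · simp [h]
    · rw [if_neg (show ¬ (0 - a + b - 2 * p * 0 = 0) by omega)]; simp [h]
  · intro j hj
    simp only [hg_zero q0 q1]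
    have : j ≤ -1 ∨ 1 ≤ j := by omega
    rw [if_neg, if_neg]
    · simp
    · intro h
      rcases this with h2 | h2 <;> nlinarith
    · intro h
      rcases this with h2 | h2 <;> nlinarith

lemma Jc_eq {t : ℝ} (ht0 : 0 < t) (ht1 : t < 1) (p a : ℕ) (hp : 4 ≤ p) (ha : 1 ≤ a)
    (ha2 : a ≤ p - 2) (k : ℕ) : ∀ b : ℕ, 2 ≤ b → b ≤ p - 1 →
    t ^ ((a : ℤ) - b) * Sc t (p - 1 - a) (p - b) (b - 2) k = Ib t p a k b := by
  induction k using Nat.strong_induction_on with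
  | _ k ih =>
  intro b hb hb2
  rcases k with _ | k
  · rw [Nat.cast_zero, Sc_0 ht0 ht1, Ib_zero ht0 ht1 (by omega) (by omega) (by omega) (by omega)]
    by_cases h : a = b
    · subst h
      rw [if_pos (by omega), if_pos rfl]; simp
    · rw [if_neg (by omega), if_neg (by omega)]; simp
  · have hp0 : (0 : ℤ) < p := by omega
    have next : t ^ ((a : ℤ) - b) * (t⁻¹ * Sc t (p - 1 - a) (p - b - 1) (b - 1) k)
        = Ib t p a k (b + 1) := by
      rw [← mul_assoc, ← zpow_neg_one, ← zpow_add₀ ht0.ne']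
      by_cases h : b + 1 = p
      · have e : (b : ℤ) + 1 = p := by omega
        rw [e, Ib_p t hp0, show p - b - 1 = 0 by omega, Sc]
        simp [Qc_zero]
      · rw [show (b : ℤ) + 1 = ((b + 1 : ℕ) : ℤ) by push_cast; ring,
          ← ih k (by omega) (b + 1) (by omega) (by omega)]
        congr 1
        congr 1; push_cast; ring
    push_cast
    rcases hb.eq_or_lt with h | h
    · subst h
      have R := Sc_rec0 ht0 ht1 (p - 1 - a) (p - 3) k (by omega)
      rw [show p - 3 + 1 = p - 2 by omega] at R
      rw [show p - 2 - 1 = p - 3 by omega] at next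
      simp only [Nat.sub_self, Nat.reduceSub] at next ⊢
      rw [R, mul_add, next, Ib_rec ht0 ht1 hp0 _ _ _ (by omega), add_assoc]
      congr 1
      rcases k with _ | k
      · have S := Sc_neg1 ht0 ht1 (p - 1 - a) (p - 3) (by omega)
        rw [show p - 3 + 1 = p - 2 by omega] at S
        simp only [Nat.cast_zero, zero_sub, mul_zero, zpow_zero, one_mul, sub_self, zero_mul,
          add_zero]
        rw [S, show ((2 : ℕ) : ℤ) - 1 = 1 by norm_num,
          Ib_zero ht0 ht1 (by omega) (by omega) (by omega) (by omega)]
        by_cases h1 : a = 1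
        · subst h1
          rw [if_pos (by omega), if_pos (by simp)]
          push_cast
          norm_num
          exact inv_mul_cancel₀ ht0.ne'
        · rw [if_neg (by omega), if_neg (by omega), mul_zero]
      · have e : ((k + 1 : ℕ) : ℤ) - 1 = (k : ℤ) := by push_cast; ring
        have I := ih k (by omega) 2 (by omega) (by omega)
        have O := Ib_one ht0 ht1 p a ((k + 1 : ℕ) : ℤ) (by omega)
        rw [e] at O
        rw [e, show ((2 : ℕ) : ℤ) - 1 = 1 by norm_num, O]
        simp only [Nat.sub_self] at I
        push_cast at I ⊢
        linear_combination t ^ (4 * ((k : ℤ) + 1)) * I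
    · obtain ⟨b, rfl⟩ : ∃ c, b = c + 3 := ⟨b - 3, by omega⟩
      have R := Sc_rec ht0 ht1 (p - 1 - a) (p - (b + 3) - 1) b k (by omega)
      rw [show p - (b + 3) - 1 + 1 = p - (b + 3) by omega,
        show p - (b + 3) - 1 + 2 = p - (b + 2) by omega] at R
      rw [show b + 3 - 1 = b + 2 by omega] at next
      rw [show b + 3 - 2 = b + 1 by omega, R, mul_add, mul_add, next,
        Ib_rec ht0 ht1 hp0 _ _ _ (by omega)]
      have I := ih k (by omega) (b + 2) (by omega) (by omega)
      rw [show b + 2 - 2 = b by omega] at I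
      have I2 : (t ^ (4 * (k : ℤ)) - 1) * (t ^ ((a : ℤ) - ((b + 3 : ℕ) : ℤ)) *
          Sc t (p - 1 - a) (p - (b + 3)) (b + 1) ((k : ℤ) - 1)) =
          (t ^ (4 * (k : ℤ)) - 1) * Ib t p a ((k : ℤ) - 1) ((b + 3 : ℕ) : ℤ) := by
        rcases k with _ | k
        · simp
        · have I3 := ih k (by omega) (b + 3) (by omega) (by omega)
          rw [show ((k + 1 : ℕ) : ℤ) - 1 = (k : ℤ) by push_cast; ring, ← I3]
          rfl
      have e1 : t ^ ((a : ℤ) - ((b + 3 : ℕ) : ℤ)) * t = t ^ ((a : ℤ) - ((b + 2 : ℕ) : ℤ)) := by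
        nth_rw 2 [← zpow_one t]
        rw [← zpow_add₀ ht0.ne']; congr 1; push_cast; ring
      rw [show ((b + 3 : ℕ) : ℤ) - 1 = ((b + 2 : ℕ) : ℤ) by push_cast; ring, ← I, ← e1]
      linear_combination I2

lemma tri_eq {t : ℝ} (ht0 : 0 < t) (ht1 : t < 1) (n : ℤ) (L : ℕ) (A : ℤ) :
    t ^ (A ^ 2 - 2 * n * A) * qTri (t ^ 4) n L A =
      ∑ k ∈ range (L + 1), t ^ ((k : ℤ) ^ 2 - 2 * n * k) * gb (t ^ 4) L k
        * hg (t ^ 4) k (k - A) := by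
  have q0 : 0 < t ^ 4 := by positivity
  have q1 : t ^ 4 < 1 := pow_lt_one₀ ht0.le ht1 (by norm_num)
  unfold qTri
  split_ifs with hA
  · rw [abs_le] at hA
    rw [Finset.mul_sum]
    refine Finset.sum_bij_ne_zero (fun j _ _ => (2 * (j : ℤ) + A).toNat) ?_ ?_ ?_ ?_
    · intro j hj h
      have h2 : 0 ≤ (j : ℤ) + A ∧ 0 ≤ (L : ℤ) - 2 * j - A := by
        by_contra hc; rw [if_neg hc] at h; simp at h
      rw [mem_range]; omega
    · intro j hj h j' hj' h' e
      have h2 : 0 ≤ (j : ℤ) + A ∧ 0 ≤ (L : ℤ) - 2 * j - A := by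
        by_contra hc; rw [if_neg hc] at h; simp at h
      have h3 : 0 ≤ (j' : ℤ) + A ∧ 0 ≤ (L : ℤ) - 2 * j' - A := by
        by_contra hc; rw [if_neg hc] at h'; simp at h'
      omega
    · intro k hk h
      rw [mem_range] at hk
      obtain ⟨⟨r, hr⟩, h2, h3⟩ := hg_ne (right_ne_zero_of_mul h)
      refine ⟨r.toNat, by rw [mem_range]; omega, ?_, by omega⟩
      rw [if_pos (by omega)]
      have := qPoch_pos q0 q1
      refine mul_ne_zero (zpow_ne_zero _ ht0.ne') (div_ne_zero (mul_ne_zero ?_ (this _).ne') ?_)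
      · exact zpow_ne_zero _ q0.ne'
      · exact mul_ne_zero (mul_ne_zero (this _).ne' (this _).ne') (this _).ne'
    · intro j hj h
      have h2 : 0 ≤ (j : ℤ) + A ∧ 0 ≤ (L : ℤ) - 2 * j - A := by
        by_contra hc; rw [if_neg hc] at h; simp at h
      rw [if_pos h2]
      obtain ⟨i, hi⟩ : ∃ i : ℕ, (i : ℤ) = j + A := ⟨((j : ℤ) + A).toNat, by omega⟩
      obtain ⟨d, hd⟩ : ∃ d : ℕ, (d : ℤ) = (L : ℤ) - 2 * j - A :=
        ⟨((L : ℤ) - 2 * j - A).toNat, by omega⟩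
      have eA : A = (i : ℤ) - j := by omega
      have eL : L = (j + i) + d := by omega
      rw [← hi, ← hd]
      simp only [Int.toNat_natCast]
      rw [show (2 * (j : ℤ) + A).toNat = j + i by omega, eA]
      have e1 : hg (t ^ 4) ((j + i : ℕ) : ℤ) (((j + i : ℕ) : ℤ) - ((i : ℤ) - j)) =
          qPoch (t ^ 4) (j + i) / (qPoch (t ^ 4) j * qPoch (t ^ 4) i) := by
        unfold hg
        rw [show (((j + i : ℕ) : ℤ) - ((i : ℤ) - j)) = (j : ℤ) + j by push_cast; ring,
          if_pos ⟨_, rfl⟩, show ((j : ℤ) + j) / 2 = j by omega, ← gb_nat]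
        push_cast; rfl
      have e2 : gb (t ^ 4) (L : ℤ) ((j + i : ℕ) : ℤ) =
          qPoch (t ^ 4) L / (qPoch (t ^ 4) (j + i) * qPoch (t ^ 4) d) := by
        rw [eL, ← gb_nat]; push_cast; rfl
      rw [e1, e2, q4 ht0]
      have e3 : t ^ (((i : ℤ) - j) ^ 2 - 2 * n * ((i : ℤ) - j)) *
          t ^ (4 * ((j : ℤ) * (i - n))) =
          t ^ (((j + i : ℕ) : ℤ) ^ 2 - 2 * n * ((j + i : ℕ) : ℤ)) := by
        rw [← zpow_add₀ ht0.ne']; congr 1; push_cast; ring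
      rw [← e3]
      have hq := fun k => (qPoch_pos q0 q1 k).ne'
      generalize t ^ (((i : ℤ) - j) ^ 2 - 2 * n * ((i : ℤ) - j)) = x1
      generalize t ^ (4 * ((j : ℤ) * (i - n))) = x2
      have g1 := hq (j + i)
      have g2 := hq j
      have g3 := hq i
      have g4 := hq d
      field_simp
  · rw [mul_zero]
    symm
    apply Finset.sum_eq_zero
    intro k hk
    rw [mem_range] at hk
    by_contra h
    have := hg_ne (right_ne_zero_of_mul h)
    apply hA
    rw [abs_le]
    omega

lemma bos_gen {t : ℝ} (ht0 : 0 < t) (ht1 : t < 1) {p : ℤ} (hp : 0 < p) (n a b : ℤ) (L : ℕ)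
    (φ : ℤ) (E1 E2 : ℤ → ℤ)
    (h1 : ∀ j, φ + 4 * E1 j = (b - a) + 4 * (j * (p * j + a - p)) +
      ((2 * p * j + a - b) ^ 2 - 2 * n * (2 * p * j + a - b)))
    (h2 : ∀ j, φ + 4 * E2 j = (b - a) + 4 * ((j + 1) * (p * j + a)) +
      ((2 * p * j + a + b) ^ 2 - 2 * n * (2 * p * j + a + b))) :
    t ^ φ * ∑' j : ℤ, ((t ^ 4) ^ E1 j * qTri (t ^ 4) n L (2 * p * j + a - b)
      - (t ^ 4) ^ E2 j * qTri (t ^ 4) n L (2 * p * j + a + b)) =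
    ∑ k ∈ range (L + 1), t ^ ((k : ℤ) ^ 2 - 2 * n * k) * gb (t ^ 4) L k *
      (t ^ (b - a) * Ib t p a k b) := by
  unfold Ib
  simp only [← tsum_mul_left]
  rw [← Summable.tsum_finsetSum]
  · congr 1; funext j
    have T1 := tri_eq ht0 ht1 n L (2 * p * j + a - b)
    have T2 := tri_eq ht0 ht1 n L (2 * p * j + a + b)
    rw [q4 ht0, q4 ht0, mul_sub, ← mul_assoc, ← mul_assoc, ← zpow_add₀ ht0.ne',
      ← zpow_add₀ ht0.ne', h1, h2, zpow_add₀ ht0.ne', zpow_add₀ ht0.ne' _ (_ - _),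
      mul_assoc _ _ (qTri _ _ _ _), mul_assoc _ _ (qTri _ _ _ _), T1, T2,
      Finset.mul_sum, Finset.mul_sum, ← Finset.sum_sub_distrib]
    apply Finset.sum_congr rfl
    intro k _
    rw [zpow_add₀ ht0.ne', zpow_add₀ ht0.ne',
      show (k : ℤ) - (2 * p * j + a - b) = k - a + b - 2 * p * j by ring,
      show (k : ℤ) - (2 * p * j + a + b) = k - a - b - 2 * p * j by ring]
    ring
  · intro k _
    exact ((Ib_summ t hp a k b).mul_left _).mul_left _

lemma B_eq {t : ℝ} (ht0 : 0 < t) (ht1 : t < 1) {p : ℤ} (hp : 0 < p) (a b : ℤ) (L : ℕ) :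
    t ^ ((b - a) * (b - a + 1)) * Bpoly (t ^ 4) p a b (b + 1) L =
    ∑ k ∈ range (L + 1), t ^ ((k : ℤ) ^ 2 - 2 * 0 * k) * gb (t ^ 4) L k *
      (t ^ (b - a) * Ib t p a k b) := by
  unfold Bpoly
  exact bos_gen ht0 ht1 hp 0 a b L _ (fun j => p * (p + 1) * j ^ 2 + j * ((p + 1) * a - p * (b + 1)))
    (fun j => (p * j + a) * ((p + 1) * j + (b + 1))) (fun j => by ring) (fun j => by ring)

lemma Bt_eq {t : ℝ} (ht0 : 0 < t) (ht1 : t < 1) {p : ℤ} (hp : 0 < p) (a b : ℤ) (L : ℕ) :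
    t ^ ((b - a) * (b - a + 3)) * Btpoly (t ^ 4) p a b (b + 2) L =
    ∑ k ∈ range (L + 1), t ^ ((k : ℤ) ^ 2 - 2 * 1 * k) * gb (t ^ 4) L k *
      (t ^ (b - a) * Ib t p a k b) := by
  unfold Btpoly
  exact bos_gen ht0 ht1 hp 1 a b L _ (fun j => p * (p + 1) * j ^ 2 + j * ((p + 1) * a - p * (b + 2)))
    (fun j => p * (p + 1) * j ^ 2 + j * ((p + 1) * a + p * (b + 2 - 2)) + a * (b + 2 - 1) - b)
    (fun j => by ring) (fun j => by ring)

/-- the weight of one node of the chain, at distance `e` from the end -/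
def gw (t : ℝ) (a b e : ℕ) (x y z : ℤ) : ℝ :=
  t ^ ((x - y) ^ 2 - 2 * csrc b e * y) * hb (t ^ 4) (x + z + csrc a e + csrc b e) y

/-- the chain with two sources, direct definition -/
def Wc (t : ℝ) (a b : ℕ) : ℕ → ℤ → ℤ → ℝ
  | 0 => V0
  | n + 1 => fun x y => ∑' z : ℤ, gw t a b n x y z * Wc t a b n y z

lemma Wc_lo (t : ℝ) (a b n : ℕ) (h : n ≤ b) : Wc t a b n = Vc t a n := by
  induction n with
  | zero => rfl
  | succ n ih =>
    funext x y
    change ∑' z : ℤ, gw t a b n x y z * Wc t a b n y z = step _ _ _ _ _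
    rw [ih (by omega)]
    unfold step gw
    rw [← tsum_mul_left]
    congr 1; funext z
    rw [show csrc b n = 0 by unfold csrc; rw [if_neg (by omega)]]
    simp only [mul_zero, zero_mul, sub_zero, add_zero]
    ring

lemma Wc_hi {t : ℝ} (ht0 : 0 < t) (a b j : ℕ) : Wc t a b (b + 1 + j) = Qc t a (b + 1) j := by
  induction j with
  | zero =>
    funext x y
    change ∑' z : ℤ, gw t a b b x y z * Wc t a b b y z = t ^ (-2 * x - 1) * step _ _ _ _ _
    rw [Wc_lo _ _ _ _ le_rfl]
    unfold step gw
    rw [← mul_assoc, ← zpow_add₀ ht0.ne', ← tsum_mul_left]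
    congr 1; funext z
    rw [show csrc b b = 1 by simp [csrc], ← mul_assoc]
    congr 1
    congr 1
    · congr 1; ring
    · congr 1; ring
  | succ j ih =>
    funext x y
    change ∑' z : ℤ, gw t a b (b + 1 + j) x y z * Wc t a b (b + 1 + j) y z = step _ _ _ _ _
    rw [ih]
    unfold step gw
    rw [← tsum_mul_left]
    congr 1; funext z
    rw [show csrc b (b + 1 + j) = 0 by unfold csrc; rw [if_neg (by omega)]]
    simp only [mul_zero, zero_mul, sub_zero, add_zero]
    ring

lemma gw_nonneg {t : ℝ} (ht0 : 0 < t) (ht1 : t < 1) (a b e : ℕ) (x y z : ℤ) :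
    0 ≤ gw t a b e x y z := by
  have q0 : 0 < t ^ 4 := by positivity
  have q1 : t ^ 4 < 1 := pow_lt_one₀ ht0.le ht1 (by norm_num)
  exact mul_nonneg (zpow_nonneg ht0.le _) (hb_nonneg q0 q1 _ _)

lemma Wc_nonneg {t : ℝ} (ht0 : 0 < t) (ht1 : t < 1) (a b n : ℕ) (x y : ℤ) :
    0 ≤ Wc t a b n x y := by
  induction n generalizing x y with
  | zero => change 0 ≤ V0 x y; unfold V0; split_ifs <;> simp
  | succ n ih => exact tsum_nonneg fun z => mul_nonneg (gw_nonneg ht0 ht1 _ _ _ _ _ _) (ih _ _)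

lemma Wc_BD {t : ℝ} (ht0 : 0 < t) (a b n : ℕ) : BD (Wc t a b n) := by
  rcases Nat.lt_or_ge b n with h | h
  · obtain ⟨j, rfl⟩ := Nat.exists_eq_add_of_lt h
    rw [show b + j + 1 = b + 1 + j by omega, Wc_hi ht0]
    exact Qc_BD _ _ _ _
  · rw [Wc_lo _ _ _ _ h]; exact Vc_BD _ _ _

/-- number of sources seen, recursive -/
def al (c : ℕ) : ℕ → ℤ
  | 0 => 0
  | 1 => csrc c 0
  | n + 2 => al c n + csrc c (n + 1)

lemma al_eq (c n : ℕ) : al c n = if c < n ∧ (n - c) % 2 = 1 then 1 else 0 := by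
  induction n using Nat.twoStepInduction with
  | zero => simp [al]
  | one => unfold al csrc; split_ifs <;> omega
  | more n h1 h2 =>
    rw [al, h1]; unfold csrc
    split_ifs <;> omega

lemma Wc_par {t : ℝ} (a b n : ℕ) (x y : ℤ) (h : Wc t a b (n + 1) x y ≠ 0) :
    Even (y - al a n - al b n) ∧ Even (x - al a (n + 1) - al b (n + 1)) := by
  induction n generalizing x y with
  | zero =>
    obtain ⟨z, hz⟩ : ∃ z, gw t a b 0 x y z * Wc t a b 0 y z ≠ 0 := by
      by_contra hc
      push Not at hc
      exact h (by change ∑' z : ℤ, gw t a b 0 x y z * Wc t a b 0 y z = 0; simp [hc])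
    have h1 := right_ne_zero_of_mul hz
    have h2 := (hb_ne (right_ne_zero_of_mul (left_ne_zero_of_mul hz))).1
    have h3 : y = 0 ∧ z = 0 := by
      by_contra hc
      exact h1 (by change V0 y z = 0; simp [V0, hc])
    rw [h3.1]; rw [h3.2] at h2
    simp only [al]
    simp only [Int.even_iff] at *
    constructor <;> omega
  | succ n ih =>
    obtain ⟨z, hz⟩ : ∃ z, gw t a b (n + 1) x y z * Wc t a b (n + 1) y z ≠ 0 := by
      by_contra hc
      push Not at hc
      exact h (by change ∑' z : ℤ, gw t a b (n + 1) x y z * Wc t a b (n + 1) y z = 0; simp [hc])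
    have h1 := ih _ _ (right_ne_zero_of_mul hz)
    have h2 := (hb_ne (right_ne_zero_of_mul (left_ne_zero_of_mul hz))).1
    refine ⟨h1.2, ?_⟩
    have h3 := h1.1
    simp only [al]
    simp only [Int.even_iff] at *
    omega

/-- the sequence of values along the chain -/
def sqn {d : ℕ} (x y : ℤ) (r : Fin d → ℕ) : ℕ → ℤ
  | 0 => x
  | 1 => y
  | i + 2 => if h : i < d then (r ⟨i, h⟩ : ℤ) else 0

/-- weight of a whole configuration -/
def PP (t : ℝ) (a b d : ℕ) (x y : ℤ) (r : Fin d → ℕ) : ℝ :=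
  ∏ i ∈ range (d + 2), gw t a b (d + 1 - i) (sqn x y r i) (sqn x y r (i + 1)) (sqn x y r (i + 2))

lemma sqn_cons {d : ℕ} (x y : ℤ) (z : ℕ) (r : Fin d → ℕ) (i : ℕ) :
    sqn x y (Fin.cons z r : Fin (d + 1) → ℕ) (i + 1) = sqn y z r i := by
  rcases i with _ | _ | i
  · rfl
  · simp [sqn]
  · simp only [sqn]
    by_cases h : i < d
    · rw [dif_pos h, dif_pos (by omega)]
      rfl
    · rw [dif_neg h, dif_neg (by omega)]

lemma PP_cons (t : ℝ) (a b d : ℕ) (x y : ℤ) (z : ℕ) (r : Fin d → ℕ) :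
    PP t a b (d + 1) x y (Fin.cons z r : Fin (d + 1) → ℕ) =
      gw t a b (d + 2) x y z * PP t a b d y z r := by
  unfold PP
  rw [Finset.prod_range_succ', mul_comm]
  congr 1
  apply Finset.prod_congr rfl
  intro i _
  rw [sqn_cons, sqn_cons, sqn_cons, show d + 1 + 1 - (i + 1) = d + 1 - i by omega]

lemma PP_nonneg {t : ℝ} (ht0 : 0 < t) (ht1 : t < 1) (a b d : ℕ) (x y : ℤ) (r : Fin d → ℕ) :
    0 ≤ PP t a b d x y r := Finset.prod_nonneg fun _ _ => gw_nonneg ht0 ht1 _ _ _ _ _ _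

lemma hasSum_prod_nonneg {α β : Type} {f : α × β → ℝ} {g : α → ℝ} {s : ℝ} (hf : ∀ x, 0 ≤ f x)
    (h : ∀ x, HasSum (fun y => f (x, y)) (g x)) (hg : HasSum g s) : HasSum f s := by
  have h1 : Summable f := by
    rw [summable_prod_of_nonneg hf]
    refine ⟨fun x => (h x).summable, ?_⟩
    have : (fun x => ∑' y, f (x, y)) = g := by funext x; exact (h x).tsum_eq
    rw [this]; exact hg.summable
  have h2 := h1.hasSum.prod_fiberwise h
  rw [hg.unique h2]
  exact h1.hasSum

lemma hasSum_nat_of_int {F : ℤ → ℝ} (hs : Summable F) (h : ∀ z, z < 0 → F z = 0) :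
    HasSum (fun z : ℕ => F z) (∑' z, F z) := by
  have := (Function.Injective.hasSum_iff (f := F) (a := ∑' z, F z) (Nat.cast_injective (R := ℤ)) (by
    intro z hz
    apply h
    by_contra hc
    exact hz ⟨z.toNat, by omega⟩)).2 hs.hasSum
  exact this

lemma PP_hasSum {t : ℝ} (ht0 : 0 < t) (ht1 : t < 1) (a b d : ℕ) (x y : ℤ) :
    HasSum (fun r : Fin d → ℕ => PP t a b d x y r) (Wc t a b (d + 2) x y) := by
  induction d generalizing x y with
  | zero =>
    have e : Wc t a b 2 x y = PP t a b 0 x y Fin.elim0 := by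
      change ∑' z : ℤ, gw t a b 1 x y z * Wc t a b 1 y z = _
      have h1 : ∀ z, Wc t a b 1 y z = if z = 0 then gw t a b 0 y 0 0 else 0 := by
        intro z
        change ∑' w : ℤ, gw t a b 0 y z w * V0 z w = _
        rw [tsum_eq_single 0]
        · by_cases hz : z = 0 <;> simp [V0, hz]
        · intro w hw; simp [V0, hw]
      rw [tsum_eq_single 0]
      · rw [h1]; simp [PP, Finset.prod_range_succ, sqn]
      · intro z hz; rw [h1]; simp [hz]
    rw [e]
    have : (fun r : Fin 0 → ℕ => PP t a b 0 x y r) = fun _ => PP t a b 0 x y Fin.elim0 := by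
      funext r; rw [Subsingleton.elim r Fin.elim0]
    rw [this]
    exact hasSum_unique _
  | succ d ih =>
    rw [← (Fin.consEquiv (fun _ : Fin (d + 1) => ℕ)).hasSum_iff]
    have hsum : HasSum (fun z : ℕ => gw t a b (d + 2) x y z * Wc t a b (d + 2) y z)
        (Wc t a b (d + 1 + 2) x y) := by
      apply hasSum_nat_of_int (F := fun z : ℤ => gw t a b (d + 2) x y z * Wc t a b (d + 2) y z)
      · exact (Wc_BD ht0 a b (d + 2)).summ0 _ _
      · intro z hz
        simp only [(Wc_BD ht0 a b (d + 2)).neg hz, mul_zero]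
    refine hasSum_prod_nonneg ?_ ?_ hsum
    · intro z; exact PP_nonneg ht0 ht1 _ _ _ _ _ _
    · intro z
      have := (ih y z).mul_left (gw t a b (d + 2) x y z)
      have e : (fun r : Fin d → ℕ => gw t a b (d + 2) x y z * PP t a b d y z r) =
          fun r => PP t a b (d + 1) x y (Fin.cons z r : Fin (d + 1) → ℕ) := by
        funext r
        exact (PP_cons t a b d x y z r).symm
      rw [e] at this
      exact this

lemma PP_hasSum2 {t : ℝ} (ht0 : 0 < t) (ht1 : t < 1) (a b d : ℕ) (hb : b ≤ d + 1) (x : ℤ) :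
    HasSum (fun r : ℕ × (Fin d → ℕ) => PP t a b d x r.1 r.2) (Sc t a (b + 1) (d + 1 - b) x) := by
  have e : Wc t a b (d + 2) = Qc t a (b + 1) (d + 1 - b) := by
    rw [← Wc_hi ht0]; congr 1; omega
  refine hasSum_prod_nonneg (g := fun y : ℕ => Wc t a b (d + 2) x y) ?_ ?_ ?_
  · intro r; exact PP_nonneg ht0 ht1 _ _ _ _ _ _
  · intro y; exact PP_hasSum ht0 ht1 a b d x y
  · unfold Sc
    rw [← e]
    exact hasSum_nat_of_int ((Wc_BD ht0 a b (d + 2)).summ1 x)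
      (fun z hz => (Wc_BD ht0 a b (d + 2)).neg hz)

lemma vandermonde {q : ℝ} (h0 : 0 < q) (h1 : q < 1) (s N k : ℕ) :
    gb q ((s : ℤ) + N) k = ∑ x ∈ antidiagonal k,
      q ^ ((x.1 : ℤ) * (s - x.2)) * gb q s x.2 * gb q N x.1 := by
  induction s generalizing k with
  | zero =>
    rw [Finset.sum_eq_single (k, 0)]
    · simp [gb_zero h0 h1]
    · intro x hx hne
      rw [HasAntidiagonal.mem_antidiagonal] at hx
      have : 0 < x.2 := by
        rcases Nat.eq_zero_or_pos x.2 with h | h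
        · exact absurd (Prod.ext (by simp; omega) h) hne
        · exact h
      rw [gb_big q (show ((0 : ℕ) : ℤ) < x.2 by omega)]; simp
    · intro h; simp at h
  | succ s ih =>
    rcases k with _ | k
    · simp only [Nat.cast_zero, Finset.Nat.antidiagonal_zero, sum_singleton]
      rw [gb_zero h0 h1 (by omega), gb_zero h0 h1 (by omega), gb_zero h0 h1 (by omega)]
      simp
    · have R := (gb_rec h0 h1 (show (0 : ℤ) ≤ (s : ℤ) + N by omega) k).1
      have i1 := ih k
      have i2 := ih (k + 1)
      push_cast at i2 R ⊢
      rw [show (s : ℤ) + 1 + N = s + N + 1 by ring, R, i1, i2]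
      have e : ∀ x ∈ antidiagonal (k + 1),
          q ^ ((x.1 : ℤ) * (s + 1 - x.2)) * gb q (s + 1) x.2 * gb q N x.1 =
          q ^ ((x.1 : ℤ) * (s + 1 - x.2)) * gb q s (x.2 - 1) * gb q N x.1 +
          q ^ ((k : ℤ) + 1) * (q ^ ((x.1 : ℤ) * (s - x.2)) * gb q s x.2 * gb q N x.1) := by
        intro x hx
        rw [HasAntidiagonal.mem_antidiagonal] at hx
        have R2 := (gb_rec h0 h1 (show (0 : ℤ) ≤ (s : ℤ) by omega) ((x.2 : ℤ) - 1)).1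
        rw [sub_add_cancel] at R2
        rw [R2]
        have : q ^ ((x.1 : ℤ) * (s + 1 - x.2)) * q ^ (x.2 : ℤ) =
            q ^ ((k : ℤ) + 1) * q ^ ((x.1 : ℤ) * (s - x.2)) := by
          rw [← zpow_add₀ h0.ne', ← zpow_add₀ h0.ne']
          congr 1
          rw [show (k : ℤ) + 1 = x.1 + x.2 by exact_mod_cast hx.symm]; ring
        linear_combination gb q s x.2 * gb q N x.1 * this
      rw [Finset.sum_congr rfl e, Finset.sum_add_distrib, ← Finset.mul_sum]
      congr 1
      rw [Finset.Nat.sum_antidiagonal_succ']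
      rw [gb_neg q (show ((0 : ℕ) : ℤ) - 1 < 0 by norm_num)]
      simp only [mul_zero, zero_mul, zero_add]
      apply Finset.sum_congr rfl
      intro x _
      push_cast
      rw [show (s : ℤ) + 1 - (x.2 + 1) = s - x.2 by ring, show (x.2 : ℤ) + 1 - 1 = x.2 by ring]

/-- head weight -/
def Hd (t : ℝ) (L : ℕ) (ε : ℤ) (y : ℤ) (m0 m1 : ℕ) : ℝ :=
  t ^ (((m0 : ℤ) + m1) ^ 2 - 2 * ε * (m0 + m1) + 2 * m0 * (y + ε - 2 * m1)) *
    hb (t ^ 4) (y + ε) m1 * hb (t ^ 4) (2 * L - y - ε) m0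

lemma Hd_nonneg {t : ℝ} (ht0 : 0 < t) (ht1 : t < 1) (L : ℕ) (ε y : ℤ) (m0 m1 : ℕ) :
    0 ≤ Hd t L ε y m0 m1 := by
  have q0 : 0 < t ^ 4 := by positivity
  have q1 : t ^ 4 < 1 := pow_lt_one₀ ht0.le ht1 (by norm_num)
  exact mul_nonneg (mul_nonneg (zpow_nonneg ht0.le _) (hb_nonneg q0 q1 _ _)) (hb_nonneg q0 q1 _ _)

lemma Hd_hasSum {t : ℝ} (ht0 : 0 < t) (ht1 : t < 1) (L : ℕ) (ε y : ℤ) (P : ℤ → ℝ)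
    (hε : 0 ≤ ε) (hy : 0 ≤ y) (hP : ∀ k : ℕ, k ≤ L → P k ≠ 0 → Even (y + ε) ∧ y + ε ≤ 2 * L) :
    HasSum (fun x : ℕ × ℕ => Hd t L ε y x.1 x.2 * P (x.1 + x.2))
      (∑ k ∈ range (L + 1), t ^ ((k : ℤ) ^ 2 - 2 * ε * k) * gb (t ^ 4) L k * P k) := by
  have q0 : 0 < t ^ 4 := by positivity
  have q1 : t ^ 4 < 1 := pow_lt_one₀ ht0.le ht1 (by norm_num)
  have hsupp : ∀ x : ℕ × ℕ, Hd t L ε y x.1 x.2 ≠ 0 → x.1 + x.2 ≤ L := by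
    intro x hx
    have h1 := hb_ne (right_ne_zero_of_mul hx)
    have h2 := hb_ne (right_ne_zero_of_mul (left_ne_zero_of_mul hx))
    omega
  have key : ∀ k ∈ range (L + 1), ∑ x ∈ antidiagonal k, Hd t L ε y x.1 x.2 * P (x.1 + x.2) =
      t ^ ((k : ℤ) ^ 2 - 2 * ε * k) * gb (t ^ 4) L k * P k := by
    intro k hk
    rw [mem_range] at hk
    have e : ∑ x ∈ antidiagonal k, Hd t L ε y x.1 x.2 * P (x.1 + x.2) =
        (∑ x ∈ antidiagonal k, Hd t L ε y x.1 x.2) * P k := by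
      rw [Finset.sum_mul]
      apply Finset.sum_congr rfl
      intro x hx
      rw [HasAntidiagonal.mem_antidiagonal] at hx
      rw [← hx]; push_cast; rfl
    rw [e]
    by_cases hPk : P k = 0
    · rw [hPk]; simp
    congr 1
    obtain ⟨⟨s, hs⟩, hL⟩ := hP k (by omega) hPk
    obtain ⟨s, rfl⟩ : ∃ s' : ℕ, s = s' := ⟨s.toNat, by omega⟩
    obtain ⟨N, rfl⟩ : ∃ N : ℕ, L = s + N := ⟨L - s, by omega⟩
    rw [show (((s + N : ℕ) : ℤ)) = (s : ℤ) + N by push_cast; ring, vandermonde q0 q1, Finset.mul_sum]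
    apply Finset.sum_congr rfl
    intro x hx
    rw [HasAntidiagonal.mem_antidiagonal] at hx
    unfold Hd hb
    rw [if_pos ⟨_, hs⟩, if_pos ⟨(N : ℤ), by push_cast; omega⟩,
      show (y + ε) / 2 = s by omega, show (2 * ((s + N : ℕ) : ℤ) - y - ε) / 2 = N by omega, hs, q4 ht0,
      ← mul_assoc, ← mul_assoc, ← zpow_add₀ ht0.ne', ← hx]
    congr 3
    push_cast; ring
  rw [← Finset.sum_congr rfl key]
  set S := (range (L + 1) ×ˢ range (L + 1)).filter (fun x => x.1 + x.2 ≤ L) with hS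
  have mS : ∀ x : ℕ × ℕ, x ∈ S ↔ x.1 + x.2 ≤ L := by
    intro x
    rw [hS, mem_filter, mem_product, mem_range, mem_range]; omega
  have e : ∑ k ∈ range (L + 1), ∑ x ∈ HasAntidiagonal.antidiagonal k,
      Hd t L ε y x.1 x.2 * P (x.1 + x.2) = ∑ x ∈ S, Hd t L ε y x.1 x.2 * P (x.1 + x.2) := by
    rw [← Finset.sum_fiberwise_of_maps_to (s := S) (t := range (L + 1)) (g := fun x => x.1 + x.2)]
    · apply Finset.sum_congr rfl
      intro k hk
      rw [mem_range] at hk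
      apply Finset.sum_congr _ (fun _ _ => rfl)
      ext x
      rw [HasAntidiagonal.mem_antidiagonal, mem_filter, mS]; omega
    · intro x hx
      rw [mS] at hx
      rw [mem_range]; omega
  rw [e]
  apply hasSum_sum_of_ne_finset_zero
  intro x hx
  by_contra h
  exact hx ((mS x).2 (hsupp x (left_ne_zero_of_mul h)))

/-- extension of `m` by zero, with integer values -/
def Mx {n : ℕ} (m : Fin (n + 3) → ℕ) (i : ℕ) : ℤ := if h : i < n + 3 then (m ⟨i, h⟩ : ℤ) else 0

/-- the chain sequence attached to `m` -/
def Ex {n : ℕ} (m : Fin (n + 3) → ℕ) : ℕ → ℤ :=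
  sqn ((m 0 : ℤ) + m 1) (m 2) (fun i : Fin n => m i.succ.succ.succ)

lemma Ex_zero {n : ℕ} (m : Fin (n + 3) → ℕ) : Ex m 0 = Mx m 0 + Mx m 1 := by
  simp [Ex, sqn, Mx]

lemma Ex_succ {n : ℕ} (m : Fin (n + 3) → ℕ) (i : ℕ) : Ex m (i + 1) = Mx m (i + 2) := by
  rcases i with _ | i
  · simp only [Ex, sqn, Mx]
    rw [dif_pos (by omega)]
    rfl
  · simp only [Ex, sqn, Mx]
    by_cases h : i < n
    · rw [dif_pos h, dif_pos (by omega)]; rfl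
    · rw [dif_neg h, dif_neg (by omega)]

lemma Mx_big {n : ℕ} (m : Fin (n + 3) → ℕ) {i : ℕ} (h : n + 3 ≤ i) : Mx m i = 0 := by
  unfold Mx; rw [dif_neg (by omega)]

lemma Mx_val {n : ℕ} (m : Fin (n + 3) → ℕ) (i : Fin (n + 3)) : Mx m i.val = m i := by
  unfold Mx; rw [dif_pos i.2]

lemma Mx_nonneg {n : ℕ} (m : Fin (n + 3) → ℕ) (i : ℕ) : 0 ≤ Mx m i := by
  unfold Mx; split_ifs <;> simp

lemma sum_Mx {n : ℕ} (m : Fin (n + 3) → ℕ) (c : ℕ) :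
    ∑ j : Fin (n + 3), (if j.val = c then (1 : ℚ) else 0) * (m j : ℚ) = Mx m c := by
  have e : ∀ j : Fin (n + 3), (if j.val = c then (1 : ℚ) else 0) * (m j : ℚ) =
      (fun i : ℕ => if i = c then (Mx m i : ℚ) else 0) j.val := by
    intro j
    simp only [Mx_val]
    split_ifs <;> simp
  rw [Finset.sum_congr rfl (fun j _ => e j),
    Fin.sum_univ_eq_sum_range (fun i : ℕ => if i = c then (Mx m i : ℚ) else 0) (n + 3),
    Finset.sum_ite_eq']
  split_ifs with h
  · rfl
  · rw [mem_range] at h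
    rw [Mx_big m (by omega)]; simp

lemma It_zero {n : ℕ} (m : Fin (n + 3) → ℕ) (i : Fin (n + 3)) (hi : i.val = 0) :
    ∑ j : Fin (n + 3), ItM (n + 4) i j * (m j : ℚ) = -Mx m 2 := by
  rw [← sum_Mx, ← Finset.sum_neg_distrib]
  apply Finset.sum_congr rfl
  intro j _
  unfold ItM
  rw [if_pos hi]
  split_ifs <;> simp

lemma It_one {n : ℕ} (m : Fin (n + 3) → ℕ) (i : Fin (n + 3)) (hi : i.val = 1) :
    ∑ j : Fin (n + 3), ItM (n + 4) i j * (m j : ℚ) = Mx m 2 := by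
  rw [← sum_Mx]
  apply Finset.sum_congr rfl
  intro j _
  congr 1
  unfold ItM
  split_ifs <;> first | rfl | omega

lemma It_two {n : ℕ} (m : Fin (n + 3) → ℕ) (i : Fin (n + 3)) (c : ℕ) (hi : i.val = c + 2) :
    ∑ j : Fin (n + 3), ItM (n + 4) i j * (m j : ℚ) = Ex m c + Ex m (c + 2) := by
  have e1 : (Ex m c : ℚ) + Ex m (c + 2) = (if c = 0 then 1 else 0) * Mx m 0 + Mx m (c + 1)
      + Mx m (c + 3) := by
    rw [Ex_succ]
    rcases c with _ | c
    · rw [Ex_zero]; push_cast; simp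
    · rw [Ex_succ]; simp
  rw [e1, ← sum_Mx m 0, ← sum_Mx m (c + 1), ← sum_Mx m (c + 3), Finset.mul_sum,
    ← Finset.sum_add_distrib, ← Finset.sum_add_distrib]
  apply Finset.sum_congr rfl
  intro j _
  rw [← mul_assoc, ← add_mul, ← add_mul]
  congr 1
  unfold ItM
  split_ifs <;> first | omega | norm_num

/-- parity label -/
def eps (a b : ℕ) : ℤ := if (b + a + kdel a 1) % 2 = 1 then 1 else 0

lemma ptil_eps {p : ℕ} (a b : ℕ) (hb1 : 2 ≤ b) :
    ptil (a + kdel a 1 + b + kdel b 1 + (if (0 : ℕ) = 1 then p - 1 else 0)) = (eps a b : ℚ) := by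
  have h1 : kdel b 1 = 0 := by unfold kdel; rw [if_neg (by omega)]
  rw [h1]
  unfold ptil eps
  simp only [zero_ne_one, if_false, add_zero]
  rw [show a + kdel a 1 + b = b + a + kdel a 1 by omega]
  split_ifs <;> simp

lemma top_zero {n : ℕ} (a b L : ℕ) (hb1 : 2 ≤ b) (m : Fin (n + 3) → ℕ) (i : Fin (n + 3))
    (hi : i.val = 0) : topVec (n + 4) L (uvec (n + 4) 0 a b) m i =
      ((2 * L - Mx m 2 - eps a b : ℤ) : ℚ) / 2 := by
  have h := It_zero m i hi
  unfold topVec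
  refine (congrArg (fun s => s / 2 + (L : ℚ) * evec (n + 4) 0 i + uvec (n + 4) 0 a b i / 2) h).trans ?_
  unfold uvec
  rw [ptil_eps a b hb1]
  unfold evec
  simp only [hi]
  have e1 : (if 1 < a then if 0 = a then (1 : ℚ) else 0 else 0) = 0 := by
    split_ifs <;> first | rfl | omega
  have e2 : (if 1 < b then if 0 = b then (1 : ℚ) else 0 else 0) = 0 := by
    split_ifs <;> first | rfl | omega
  rw [e1, e2]
  push_cast
  norm_num
  ring

lemma top_one {n : ℕ} (a b L : ℕ) (hb1 : 2 ≤ b) (m : Fin (n + 3) → ℕ) (i : Fin (n + 3))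
    (hi : i.val = 1) : topVec (n + 4) L (uvec (n + 4) 0 a b) m i =
      ((Mx m 2 + eps a b : ℤ) : ℚ) / 2 := by
  have h := It_one m i hi
  unfold topVec
  refine (congrArg (fun s => s / 2 + (L : ℚ) * evec (n + 4) 0 i + uvec (n + 4) 0 a b i / 2) h).trans ?_
  unfold uvec
  rw [ptil_eps a b hb1]
  unfold evec
  simp only [hi]
  have e1 : (if 1 < a then if 1 = a then (1 : ℚ) else 0 else 0) = 0 := by
    split_ifs <;> first | rfl | omega
  have e2 : (if 1 < b then if 1 = b then (1 : ℚ) else 0 else 0) = 0 := by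
    split_ifs <;> first | rfl | omega
  rw [e1, e2]
  push_cast
  norm_num
  ring

lemma top_two {n : ℕ} (a b L : ℕ) (ha2 : a ≤ n + 2) (hb1 : 2 ≤ b) (hb2 : b ≤ n + 3)
    (m : Fin (n + 3) → ℕ) (i : Fin (n + 3)) (c : ℕ)
    (hi : i.val = c + 2) : topVec (n + 4) L (uvec (n + 4) 0 a b) m i =
      ((Ex m c + Ex m (c + 2) + csrc (n + 3 - a) (n + 1 - c) + csrc (n + 3 - b) (n + 1 - c) : ℤ) : ℚ)
        / 2 := by
  have h := It_two m i c hi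
  have hlt := i.2
  unfold topVec
  refine (congrArg (fun s => s / 2 + (L : ℚ) * evec (n + 4) 0 i + uvec (n + 4) 0 a b i / 2) h).trans ?_
  unfold uvec
  rw [ptil_eps a b hb1]
  unfold evec csrc
  simp only [hi]
  have e1 : (if 1 < a then if c + 2 = a then (1 : ℚ) else 0 else 0) =
      ((if n + 1 - c = n + 3 - a then 1 else 0 : ℤ) : ℚ) := by
    split_ifs <;> first | omega | simp
  have e2 : (if 1 < b then if c + 2 = b then (1 : ℚ) else 0 else 0) =
      ((if n + 1 - c = n + 3 - b then 1 else 0 : ℤ) : ℚ) := by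
    split_ifs <;> first | omega | simp
  rw [e1, e2]
  push_cast
  norm_num
  ring

lemma qBin_hb (q : ℝ) (S : ℤ) (m : ℕ) : qBinQ q ((S : ℚ) / 2) m = hb q S m := by
  unfold qBinQ hb
  by_cases hS : Even S
  · obtain ⟨r, rfl⟩ := hS
    have e : (((r + r : ℤ) : ℚ) / 2) = (r : ℚ) := by push_cast; ring
    rw [e, if_pos (show Even (r + r) from ⟨r, rfl⟩), show (r + r) / 2 = r by omega]
    unfold gb
    simp only [Rat.den_intCast, Rat.num_intCast, true_and]
    by_cases h : (m : ℤ) ≤ r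
    · rw [if_pos (by exact_mod_cast h), if_pos ⟨by omega, h⟩,
        show r.toNat - m = (r - m).toNat by omega, Int.toNat_natCast]
    · rw [if_neg (by exact_mod_cast h), if_neg (by omega)]
  · rw [if_neg hS, if_neg]
    rintro ⟨h, _⟩
    apply hS
    have h2 := (Rat.den_eq_one_iff _).1 h
    have h3 : (S : ℚ) = ((2 * ((S : ℚ) / 2).num : ℤ) : ℚ) := by
      push_cast; rw [h2]; ring
    have h4 : S = 2 * ((S : ℚ) / 2).num := by exact_mod_cast h3
    rw [h4]; exact even_two_mul _

lemma prod_qBin {n : ℕ} (q : ℝ) (a b L : ℕ) (ha2 : a ≤ n + 2) (hb1 : 2 ≤ b) (hb2 : b ≤ n + 3)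
    (m : Fin (n + 3) → ℕ) :
    ∏ i : Fin (n + 3), qBinQ q (topVec (n + 4) L (uvec (n + 4) 0 a b) m i) (m i) =
    hb q (2 * L - Mx m 2 - eps a b) (m 0) * (hb q (Mx m 2 + eps a b) (m 1) *
      ∏ c ∈ range (n + 1), hb q (Ex m c + Ex m (c + 2) + csrc (n + 3 - a) (n + 1 - c)
        + csrc (n + 3 - b) (n + 1 - c)) (Ex m (c + 1))) := by
  rw [Fin.prod_univ_succ, Fin.prod_univ_succ]
  congr 1
  · rw [top_zero a b L hb1 m 0 rfl, qBin_hb]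
  congr 1
  · rw [top_one a b L hb1 m _ rfl, qBin_hb]; rfl
  · rw [← Fin.prod_univ_eq_prod_range]
    apply Finset.prod_congr rfl
    intro c _
    rw [top_two a b L ha2 hb1 hb2 m _ c.val rfl, qBin_hb, Ex_succ]
    congr 1
    rw [← Mx_val, Ex_succ]; rfl

lemma sq_tel (E : ℕ → ℤ) (N : ℕ) : ∑ i ∈ range (N + 1), (E i - E (i + 1)) ^ 2 =
    E 0 ^ 2 - E 0 * E 1 + ∑ i ∈ range N, E (i + 1) * (2 * E (i + 1) - E i - E (i + 2))
      + E (N + 1) ^ 2 - E N * E (N + 1) := by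
  induction N with
  | zero => simp; ring
  | succ N ih => rw [Finset.sum_range_succ, ih, Finset.sum_range_succ _ N]; ring

lemma src_sum {n : ℕ} (b : ℕ) (hb1 : 2 ≤ b) (hb2 : b ≤ n + 3) (m : Fin (n + 3) → ℕ) :
    ∑ i ∈ range (n + 2), csrc (n + 3 - b) (n + 1 - i) * Ex m (i + 1) = Mx m b := by
  rw [Finset.sum_eq_single (b - 2)]
  · rw [Ex_succ, csrc, if_pos (by omega), show b - 2 + 2 = b by omega, one_mul]
  · intro i hi hne
    rw [mem_range] at hi
    rw [csrc, if_neg (by omega), zero_mul]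
  · intro h; rw [mem_range] at h; omega

lemma Phi_eq {n : ℕ} (a b : ℕ) (hb1 : 2 ≤ b) (hb2 : b ≤ n + 3) (m : Fin (n + 3) → ℕ) :
    PhiQ (n + 4) (Avec (n + 4) 0 a b) m =
    (((((m 0 : ℤ) + m 1) ^ 2 - 2 * eps a b * (m 0 + m 1) + 2 * m 0 * (Mx m 2 + eps a b - 2 * m 1)) +
      ∑ i ∈ range (n + 2), ((Ex m i - Ex m (i + 1)) ^ 2
        - 2 * csrc (n + 3 - b) (n + 1 - i) * Ex m (i + 1)) : ℤ) : ℚ) / 4 := by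
  have hA : ∑ j : Fin (n + 3), Avec (n + 4) 0 a b j * (m j : ℚ) = Mx m b + eps a b * Mx m 1 := by
    rw [← sum_Mx m b, ← sum_Mx m 1, Finset.mul_sum, ← Finset.sum_add_distrib]
    apply Finset.sum_congr rfl
    intro j _
    unfold Avec
    rw [ptil_eps a b hb1, if_pos (by omega)]
    unfold evec
    ring
  have hC : ∀ i : Fin (n + 3), ∑ j : Fin (n + 3), (m i : ℚ) * CtM (n + 4) i j * (m j : ℚ) =
      (m i : ℚ) * (2 * m i - ∑ j : Fin (n + 3), ItM (n + 4) i j * (m j : ℚ)) := by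
    intro i
    have e : ∀ j : Fin (n + 3), (m i : ℚ) * CtM (n + 4) i j * (m j : ℚ) =
        (if i = j then 2 * (m i : ℚ) * m j else 0) - (m i : ℚ) * (ItM (n + 4) i j * (m j : ℚ)) := by
      intro j
      unfold CtM
      by_cases h : i = j
      · have h' : (i : Fin (n + 4 - 1)) = j := h
        rw [if_pos h', if_pos h]; ring
      · have h' : ¬ ((i : Fin (n + 4 - 1)) = j) := h
        rw [if_neg h', if_neg h]; ring
    rw [Finset.sum_congr rfl (fun j _ => e j), Finset.sum_sub_distrib, Finset.sum_ite_eq,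
      if_pos (mem_univ _), ← Finset.mul_sum]
    ring
  have hB : ∑ i : Fin (n + 3), ∑ j : Fin (n + 3), (m i : ℚ) * CtM (n + 4) i j * (m j : ℚ) =
      (m 0 : ℚ) * (2 * m 0 + Mx m 2) + ((m 1 : ℚ) * (2 * m 1 - Mx m 2) +
        ((∑ i ∈ range (n + 1), Ex m (i + 1) * (2 * Ex m (i + 1) - Ex m i - Ex m (i + 2)) : ℤ) : ℚ)) := by
    rw [Finset.sum_congr rfl (fun i _ => hC i)]
    generalize hG : (fun i : Fin (n + 3) => ∑ j : Fin (n + 3), ItM (n + 4) i j * (m j : ℚ)) = G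
    have hG' : ∀ i : Fin (n + 3), G i = ∑ j : Fin (n + 3), ItM (n + 4) i j * (m j : ℚ) := by
      intro i; rw [← hG]
    rw [Finset.sum_congr rfl (fun i _ => congrArg (fun s => (m i : ℚ) * (2 * m i - s)) (hG' i).symm)]
    rw [Fin.sum_univ_succ, Fin.sum_univ_succ]
    simp only [hG']
    congr 1
    · rw [It_zero m 0 rfl]; ring
    congr 1
    · rw [It_one m _ rfl]; rfl
    · rw [← Fin.sum_univ_eq_sum_range (fun i => Ex m (i + 1) * (2 * Ex m (i + 1) - Ex m i - Ex m (i + 2)))]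
      push_cast
      apply Finset.sum_congr rfl
      intro c _
      rw [It_two m _ c.val rfl, Ex_succ m c.val]
      have : Mx m (c.val + 2) = m c.succ.succ := by rw [← Mx_val]; rfl
      rw [this]
      push_cast
      ring
  have hP : PhiQ (n + 4) (Avec (n + 4) 0 a b) m =
      (∑ i : Fin (n + 3), ∑ j : Fin (n + 3), (m i : ℚ) * CtM (n + 4) i j * (m j : ℚ)) / 4 -
        (∑ j : Fin (n + 3), Avec (n + 4) 0 a b j * (m j : ℚ)) / 2 := rfl
  rw [hP, hA, hB]
  have hs : ∑ i ∈ range (n + 2), ((Ex m i - Ex m (i + 1)) ^ 2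
        - 2 * csrc (n + 3 - b) (n + 1 - i) * Ex m (i + 1)) =
      Ex m 0 ^ 2 - Ex m 0 * Ex m 1 +
      ∑ i ∈ range (n + 1), Ex m (i + 1) * (2 * Ex m (i + 1) - Ex m i - Ex m (i + 2)) -
      2 * Mx m b := by
    rw [Finset.sum_sub_distrib, sq_tel, ← src_sum b hb1 hb2 m, Ex_succ m (n + 1),
      Mx_big m (show n + 3 ≤ n + 1 + 2 by omega), Finset.mul_sum]
    simp only [mul_assoc]
    ring
  rw [hs, Ex_succ m 0]
  have e0 : Ex m 0 = m 0 + m 1 := rfl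
  have e1 : Mx m 1 = m 1 := Mx_val m 1
  rw [e0, e1]
  push_cast
  ring

lemma prod_zpow_sum {t : ℝ} (ht0 : 0 < t) (f : ℕ → ℤ) (N : ℕ) :
    ∏ i ∈ range N, t ^ f i = t ^ ∑ i ∈ range N, f i := by
  induction N with
  | zero => simp
  | succ N ih => rw [Finset.prod_range_succ, Finset.sum_range_succ, ih, zpow_add₀ ht0.ne']

lemma rpow_quarter {t : ℝ} (ht0 : 0 < t) (X : ℤ) : (t ^ 4) ^ ((X : ℝ) / 4) = t ^ X := by
  rw [← Real.rpow_natCast, ← Real.rpow_mul ht0.le, ← Real.rpow_intCast]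
  congr 1; push_cast; ring

lemma summand {t : ℝ} (ht0 : 0 < t) (ht1 : t < 1) {n : ℕ} (a b L kk : ℕ)
    (ha2 : a ≤ n + 2) (hb1 : 2 ≤ b) (hb2 : b ≤ n + 3) (hk : kk = if b = n + 3 then 1 else 0)
    (m : Fin (n + 3) → ℕ) :
    (if mlast (n + 4) m % 2 = kk % 2 then
      (t ^ 4) ^ ((PhiQ (n + 4) (Avec (n + 4) 0 a b) m : ℝ)) *
        ∏ i : Fin (n + 3), qBinQ (t ^ 4) (topVec (n + 4) L (uvec (n + 4) 0 a b) m i) (m i) else 0) =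
    Hd t L (eps a b) (m 2) (m 0) (m 1) * PP t (n + 3 - a) (n + 3 - b) n ((m 0 : ℤ) + m 1) (m 2)
      (fun i : Fin n => m i.succ.succ.succ) := by
  have q0 : 0 < t ^ 4 := by positivity
  have q1 : t ^ 4 < 1 := pow_lt_one₀ ht0.le ht1 (by norm_num)
  have e2 : Mx m 2 = m 2 := Mx_val m 2
  have hPP : PP t (n + 3 - a) (n + 3 - b) n ((m 0 : ℤ) + m 1) (m 2)
      (fun i : Fin n => m i.succ.succ.succ) =
      t ^ (∑ i ∈ range (n + 2), ((Ex m i - Ex m (i + 1)) ^ 2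
        - 2 * csrc (n + 3 - b) (n + 1 - i) * Ex m (i + 1))) *
      ((∏ c ∈ range (n + 1), hb (t ^ 4) (Ex m c + Ex m (c + 2) + csrc (n + 3 - a) (n + 1 - c)
        + csrc (n + 3 - b) (n + 1 - c)) (Ex m (c + 1))) *
      (if mlast (n + 4) m % 2 = kk % 2 then 1 else 0)) := by
    have e : PP t (n + 3 - a) (n + 3 - b) n ((m 0 : ℤ) + m 1) (m 2)
      (fun i : Fin n => m i.succ.succ.succ) = ∏ i ∈ range (n + 2),
        gw t (n + 3 - a) (n + 3 - b) (n + 1 - i) (Ex m i) (Ex m (i + 1)) (Ex m (i + 2)) := rfl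
    rw [e]
    unfold gw
    rw [Finset.prod_mul_distrib, prod_zpow_sum ht0]
    congr 1
    rw [Finset.prod_range_succ]
    congr 1
    rw [Ex_succ, Ex_succ, Ex_succ, Mx_big m (show n + 3 ≤ n + 1 + 2 by omega),
      Mx_big m (show n + 3 ≤ n + 1 + 1 + 2 by omega)]
    have hl : mlast (n + 4) m = m ⟨n + 2, by omega⟩ := rfl
    have hM : Mx m (n + 2) = m ⟨n + 2, by omega⟩ := Mx_val m ⟨n + 2, by omega⟩
    have c1 : csrc (n + 3 - a) (n + 1 - (n + 1)) = 0 := by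
      unfold csrc; rw [if_neg (by omega)]
    have c2 : csrc (n + 3 - b) (n + 1 - (n + 1)) = kk := by
      unfold csrc; rw [hk]; split_ifs <;> first | rfl | omega
    rw [c1, c2, hl, hM]
    split_ifs with h
    · rw [hb_zero q0 q1 (by omega)]
      rw [Int.even_iff]; omega
    · by_contra h2
      have := (hb_ne h2).1
      rw [Int.even_iff] at this
      omega
  rw [hPP]
  by_cases h : mlast (n + 4) m % 2 = kk % 2
  · rw [if_pos h, if_pos h, Phi_eq a b hb1 hb2 m, prod_qBin _ a b L ha2 hb1 hb2]
    have : ∀ X : ℤ, (((X : ℚ) / 4 : ℚ) : ℝ) = (X : ℝ) / 4 := by intro X; push_cast; rfl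
    rw [this, rpow_quarter ht0, zpow_add₀ ht0.ne', e2]
    unfold Hd
    ring
  · rw [if_neg h, if_neg h]; ring

/-- splitting off the first three components -/
def splitEquiv (n : ℕ) : (Fin (n + 3) → ℕ) ≃ (ℕ × (Fin n → ℕ)) × (ℕ × ℕ) where
  toFun m := ((m 2, fun i => m i.succ.succ.succ), (m 0, m 1))
  invFun x := Fin.cons x.2.1 (Fin.cons x.2.2 (Fin.cons x.1.1 x.1.2 : Fin (n + 1) → ℕ) : Fin (n + 2) → ℕ)
  left_inv m := by
    funext i
    refine Fin.cases ?_ (fun i => ?_) i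
    · rfl
    refine Fin.cases ?_ (fun i => ?_) i
    · rfl
    refine Fin.cases ?_ (fun i => ?_) i
    · rfl
    · rfl
  right_inv x := by
    obtain ⟨⟨y, r⟩, m0, m1⟩ := x
    rfl

lemma PP_supp {t : ℝ} (ht0 : 0 < t) (ht1 : t < 1) {n : ℕ} (a b L : ℕ) (ha1 : 1 ≤ a)
    (ha2 : a ≤ n + 2) (hb1 : 2 ≤ b) (hb2 : b ≤ n + 3) (y : ℕ) (r : Fin n → ℕ) (k : ℕ) (hk : k ≤ L)
    (h : PP t (n + 3 - a) (n + 3 - b) n k y r ≠ 0) :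
    Even ((y : ℤ) + eps a b) ∧ (y : ℤ) + eps a b ≤ 2 * L := by
  have hW : Wc t (n + 3 - a) (n + 3 - b) (n + 2) k y ≠ 0 := by
    have h1 := le_hasSum (PP_hasSum ht0 ht1 (n + 3 - a) (n + 3 - b) n k y) r
      (fun s _ => PP_nonneg ht0 ht1 _ _ _ _ _ s)
    have h2 := PP_nonneg ht0 ht1 (n + 3 - a) (n + 3 - b) n k y r
    have h3 := lt_of_le_of_ne h2 (Ne.symm h)
    exact (lt_of_lt_of_le h3 h1).ne'
  have hpar := (Wc_par _ _ _ _ _ hW).1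
  have hev : Even ((y : ℤ) + eps a b) := by
    rw [al_eq, al_eq] at hpar
    unfold eps kdel
    rw [Int.even_iff] at hpar ⊢
    split_ifs at hpar ⊢ <;> omega
  have e : n + 2 = (n + 3 - b) + 1 + (b - 2) := by omega
  rw [e, Wc_hi ht0] at hW
  have hb := (Qc_bound ht0 ht1 _ _ _ _ _ (by omega) hW).1
  refine ⟨hev, ?_⟩
  have he : 0 ≤ eps a b ∧ eps a b ≤ 1 := by unfold eps; split_ifs <;> simp
  rw [Int.even_iff] at hev
  omega

lemma fFerm_eq {t : ℝ} (ht0 : 0 < t) (ht1 : t < 1) {n : ℕ} (a b L kk : ℕ) (ha1 : 1 ≤ a)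
    (ha2 : a ≤ n + 2) (hb1 : 2 ≤ b) (hb2 : b ≤ n + 3) (hk : kk = if b = n + 3 then 1 else 0) :
    fFerm (t ^ 4) (n + 4) kk L (uvec (n + 4) 0 a b) (Avec (n + 4) 0 a b) =
    ∑ k ∈ range (L + 1), t ^ ((k : ℤ) ^ 2 - 2 * eps a b * k) * gb (t ^ 4) L k *
      Sc t (n + 3 - a) (n + 3 - b + 1) (n + 1 - (n + 3 - b)) k := by
  have hε : 0 ≤ eps a b := by unfold eps; split_ifs <;> simp
  have h1 : HasSum (fun x : (ℕ × (Fin n → ℕ)) × (ℕ × ℕ) => Hd t L (eps a b) x.1.1 x.2.1 x.2.2 *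
      PP t (n + 3 - a) (n + 3 - b) n ((x.2.1 : ℤ) + x.2.2) x.1.1 x.1.2)
      (∑ k ∈ range (L + 1), t ^ ((k : ℤ) ^ 2 - 2 * eps a b * k) * gb (t ^ 4) L k *
      Sc t (n + 3 - a) (n + 3 - b + 1) (n + 1 - (n + 3 - b)) k) := by
    refine hasSum_prod_nonneg (g := fun yr => ∑ k ∈ range (L + 1),
      t ^ ((k : ℤ) ^ 2 - 2 * eps a b * k) * gb (t ^ 4) L k *
        PP t (n + 3 - a) (n + 3 - b) n k yr.1 yr.2) ?_ ?_ ?_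
    · intro x
      exact mul_nonneg (Hd_nonneg ht0 ht1 _ _ _ _ _) (PP_nonneg ht0 ht1 _ _ _ _ _ _)
    · rintro ⟨y, r⟩
      exact Hd_hasSum ht0 ht1 L (eps a b) y
        (fun k => PP t (n + 3 - a) (n + 3 - b) n k y r) hε (by omega)
        (fun k hk h => PP_supp ht0 ht1 a b L ha1 ha2 hb1 hb2 y r k hk h)
    · exact hasSum_sum fun k _ => (PP_hasSum2 ht0 ht1 _ _ n (by omega) k).mul_left _
  have h2 := (splitEquiv n).hasSum_iff.2 h1
  have h3 := h2.tsum_eq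
  rw [← h3]
  unfold fFerm
  apply tsum_congr
  intro m
  exact summand ht0 ht1 a b L kk ha2 hb1 hb2 hk m

lemma Fpoly_eq {t : ℝ} (ht0 : 0 < t) (ht1 : t < 1) (p a b L : ℕ) (hp : 4 ≤ p) (ha1 : 1 ≤ a)
    (ha2 : a ≤ p - 2) (hb1 : 2 ≤ b) (hb2 : b ≤ p - 1) :
    Fpoly (t ^ 4) p 0 a b L =
    ∑ k ∈ range (L + 1), t ^ ((k : ℤ) ^ 2 - 2 * eps a b * k) * gb (t ^ 4) L k *
      (t ^ ((b : ℤ) - a) * Ib t p a k b) := by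
  have h : Fpoly (t ^ 4) p 0 a b L =
    ∑ k ∈ range (L + 1), t ^ ((k : ℤ) ^ 2 - 2 * eps a b * k) * gb (t ^ 4) L k *
      Sc t (p - 1 - a) (p - b) (b - 2) k := by
    obtain ⟨n, rfl⟩ : ∃ n, p = n + 4 := ⟨p - 4, by omega⟩
    have e1 : n + 4 - 1 - a = n + 3 - a := by omega
    have e2 : n + 4 - b = n + 3 - b + 1 := by omega
    have e3 : b - 2 = n + 1 - (n + 3 - b) := by omega
    rw [e1, e2, e3]
    unfold Fpoly
    split_ifs with hb
    · exact fFerm_eq ht0 ht1 a b L 1 ha1 (by omega) hb1 (by omega) (by rw [if_pos (by omega)])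
    · exact fFerm_eq ht0 ht1 a b L 0 ha1 (by omega) hb1 (by omega) (by rw [if_neg (by omega)])
  rw [h]
  apply Finset.sum_congr rfl
  intro k _
  rw [← Jc_eq ht0 ht1 p a hp ha1 ha2 k b hb1 hb2, ← mul_assoc (t ^ ((b : ℤ) - a)),
    ← zpow_add₀ ht0.ne', show (b : ℤ) - a + (a - b) = 0 by ring, zpow_zero, one_mul]

/-- For `p ≥ 4`, `1 ≤ a ≤ p-2`, `2 ≤ b ≤ p-1`, `L ≥ 0` and `0 < q < 1`:
if `b + a + δ_{a,1}` is even then `F^{p,0}_{a,b}(L) = q^{φ(a,b)} B^p_{a,b}(L,b+1)`,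
and if `b + a + δ_{a,1}` is odd then `F^{p,0}_{a,b}(L) = q^{φ̃(a,b)} B̃^p_{a,b}(L,b+2)`. -/
theorem even_identity_general (p a b : ℕ) (hp : 4 ≤ p) (ha1 : 1 ≤ a) (ha2 : a ≤ p - 2)
    (hb1 : 2 ≤ b) (hb2 : b ≤ p - 1)
    (L : ℕ) (q : ℝ) (hq0 : 0 < q) (hq1 : q < 1) :
    ((b + a + kdel a 1) % 2 = 0 →
      Fpoly q p 0 a b L = q ^ (phiR (a : ℝ) (b : ℝ)) * Bpoly q p a b ((b : ℤ) + 1) L) ∧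
    ((b + a + kdel a 1) % 2 = 1 →
      Fpoly q p 0 a b L = q ^ (phitR (a : ℝ) (b : ℝ)) * Btpoly q p a b ((b : ℤ) + 2) L) := by
  obtain ⟨t, ht0, ht1, rfl⟩ : ∃ t : ℝ, 0 < t ∧ t < 1 ∧ q = t ^ 4 := by
    refine ⟨q ^ ((1 : ℝ) / 4), Real.rpow_pos_of_pos hq0 _, Real.rpow_lt_one hq0.le hq1 (by norm_num), ?_⟩
    rw [← Real.rpow_natCast, ← Real.rpow_mul hq0.le]
    norm_num
  constructor
  · intro h
    have e : phiR (a : ℝ) (b : ℝ) = ((((b : ℤ) - a) * ((b : ℤ) - a + 1) : ℤ) : ℝ) / 4 := by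
      unfold phiR; push_cast; ring
    have he : eps a b = 0 := by unfold eps; rw [if_neg (by omega)]
    rw [Fpoly_eq ht0 ht1 p a b L hp ha1 ha2 hb1 hb2, e, rpow_quarter ht0,
      B_eq ht0 ht1 (by omega) a b L, he]
  · intro h
    have e : phitR (a : ℝ) (b : ℝ) = ((((b : ℤ) - a) * ((b : ℤ) - a + 3) : ℤ) : ℝ) / 4 := by
      unfold phitR; push_cast; ring
    have he : eps a b = 1 := by unfold eps; rw [if_pos h]
    rw [Fpoly_eq ht0 ht1 p a b L hp ha1 ha2 hb1 hb2, e, rpow_quarter ht0,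
      Bt_eq ht0 ht1 (by omega) a b L, he]
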